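/- arXiv:2410.07457 — 4 statements merged into one kernel-verified Lean document; each statement's English description precedes it below -/
import Mathlib

section
/- Let N, M, K, H be positive integers, ε ≥ 0, η > 0. Let U ∈ ℝ^{N×M} be a nonzero matrix with nonnegative entries, let V^1, …, V^K ∈ ℝ^{N×M}, and set L = 2η max_{k∈[K]} ‖V^k‖₁. Let a_0, a_1, a_2, … be nonnegative weights with a_0 > 0, and for leader strategies x^1,…,x^H define b_t, z^t, θ_t, Θ_H as in the context; let Θ̄ ≥ Θ_H be any upper bound. Let g^1, …, g^H ∈ {e_1,…,e_K} with G^t = Σ_{τ=1}^t g^τ, G^0 = 0. Set ν = 1/(‖U‖₁ (1+L) √(50 N (Θ̄ + H))), let σ = (σ_1,…,σ_N) have i.i.d. coordinates exponentially distributed with rate ν, and suppose x^1, …, x^H are measurable Δ_N-valued functions of σ such that for every σ ∈ ℝ^N_{≥0} and every t ∈ {1,…,H}, ⟨𝒴_QR(x^t(σ))ᵀ Uᵀ x^t(σ), G^{t−1}⟩ + ⟨σ, x^t(σ)⟩ ≥ max_{x∈Δ_N} [⟨𝒴_QR(x)ᵀ Uᵀ x, G^{t−1}⟩ + ⟨σ,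 x⟩] − ε. Then E[ max_{x∈Δ_N} ⟨𝒴_QR(x)ᵀ Uᵀ x, G^H⟩ − Σ_{t=1}^H ⟨𝒴_QR(z^t)ᵀ Uᵀ x^t, g^t⟩ ] ≤ 10 N ‖U‖₁ (1+L) √(2 N (H + Θ̄)) + ε(13H + 1), where the expectation is over σ. -/
open MeasureTheory

/-- The law of a random vector in `ℝ^N` whose coordinates are i.i.d. exponential with rate `ν`. -/
noncomputable def expPi (N : ℕ) (ν : ℝ) : Measure (Fin N → ℝ) :=
  Measure.pi fun _ => ProbabilityTheory.expMeasure ν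

/-- The quantal response map: `(qr η V x) i = exp(η⟨V_i, x⟩) / ∑_j exp(η⟨V_j, x⟩)`,
where `V_i` is the `i`-th column of `V ∈ ℝ^{N×M}`. -/
noncomputable def qr {N M : ℕ} (η : ℝ) (V : Matrix (Fin N) (Fin M) ℝ)
    (x : Fin N → ℝ) (i : Fin M) : ℝ :=
  Real.exp (η * ∑ n, V n i * x n) / ∑ j, Real.exp (η * ∑ n, V n j * x n)

/-- The induced operator `1`-norm of a matrix `A`: `sup_{‖u‖₁ = 1} ‖A u‖₁`. -/
noncomputable def l1OpNorm {N M : ℕ} (A : Matrix (Fin N) (Fin M) ℝ) : ℝ :=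
  sSup {r : ℝ | ∃ u : Fin M → ℝ, (∑ j, |u j|) = 1 ∧ r = ∑ i, |A.mulVec u i|}

/-- The leader's payoff against quantal-responding followers:
`⟨𝒴_QR(z)ᵀ Uᵀ x, g⟩ = ∑_k g_k · xᵀ U y_{V^k}(z)`. -/
noncomputable def qrPayoff {N M K : ℕ} (η : ℝ) (U : Matrix (Fin N) (Fin M) ℝ)
    (V : Fin K → Matrix (Fin N) (Fin M) ℝ) (z x : Fin N → ℝ) (g : Fin K → ℝ) : ℝ :=
  ∑ k, g k * ∑ i, x i * ∑ j, U i j * qr η (V k) z j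

/-- Paper's `b_t = ∑_{τ=1}^t a_{t−τ} = ∑_{s<t} a_s` (for `t ≥ 1`). -/
noncomputable def memB (a : ℕ → ℝ) (t : ℕ) : ℝ := ∑ s ∈ Finset.range t, a s

/-- Paper's `θ_t = (1/b_t) ∑_{τ=1}^t a_{t−τ}(t−τ) = (1/b_t) ∑_{s<t} a_s · s` (for `t ≥ 1`). -/
noncomputable def memTheta (a : ℕ → ℝ) (t : ℕ) : ℝ :=
  (memB a t)⁻¹ * ∑ s ∈ Finset.range t, a s * s

/-- Paper's `Θ_H = ∑_{t=1}^H θ_t`. -/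
noncomputable def memThetaSum (a : ℕ → ℝ) (H : ℕ) : ℝ :=
  ∑ t ∈ Finset.range H, memTheta a (t + 1)

/-- The leader's reputation `z^t`: the weighted time-average of her strategies.  With
0-indexed rounds, at round `t` (paper's round `t+1`) it is
`z = (1/b_{t+1}) ∑_{τ≤t} a_{t−τ} x^τ`. -/
noncomputable def reput {N : ℕ} (a : ℕ → ℝ) (x : ℕ → Fin N → ℝ) (t : ℕ) : Fin N → ℝ :=
  (memB a (t + 1))⁻¹ • ∑ τ ∈ Finset.range (t + 1), a (t - τ) • x τ

open ProbabilityTheory in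
lemma aux_expMeasure_apply (r : ℝ) {s : Set ℝ} (hs : MeasurableSet s) :
    expMeasure r s = ∫⁻ y, s.indicator (exponentialPDF r) y := by
  rw [lintegral_indicator hs]
  exact withDensity_apply _ hs

open ProbabilityTheory in
lemma aux_memoryless {r c : ℝ} (hc : 0 ≤ c) {s : Set ℝ} (hs : MeasurableSet s) :
    ENNReal.ofReal (Real.exp (-(r * c))) * expMeasure r ((fun y => y + c) ⁻¹' s)
      = expMeasure r (s ∩ Set.Ici c) := by
  have hm : MeasurableSet ((fun y : ℝ => y + c) ⁻¹' s) := (measurable_id.add_const c) hs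
  rw [aux_expMeasure_apply r hm, aux_expMeasure_apply r (hs.inter measurableSet_Ici),
    ← lintegral_const_mul' _ _ ENNReal.ofReal_ne_top,
    ← lintegral_add_right_eq_self (fun y => (s ∩ Set.Ici c).indicator (exponentialPDF r) y) c]
  congr 1
  ext y
  by_cases h1 : y + c ∈ s
  · by_cases h2 : 0 ≤ y
    · rw [Set.indicator_of_mem (by simpa using h1), Set.indicator_of_mem
        (show y + c ∈ s ∩ Set.Ici c from ⟨h1, by simpa using h2⟩),
        exponentialPDF_of_nonneg h2, exponentialPDF_of_nonneg (by linarith),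
        ← ENNReal.ofReal_mul (Real.exp_pos _).le]
      congr 1
      rw [show -(r * (y + c)) = -(r * c) + -(r * y) by ring, Real.exp_add]
      ring
    · rw [Set.indicator_of_mem (by simpa using h1), Set.indicator_of_notMem
        (fun h => h2 (by simpa using h.2)), exponentialPDF_of_neg (not_le.mp h2), mul_zero]
  · rw [Set.indicator_of_notMem (by simpa using h1), Set.indicator_of_notMem
      (fun h => h1 h.1), mul_zero]

open ProbabilityTheory in
lemma aux_ae_nonneg_one (r : ℝ) : ∀ᵐ y ∂(expMeasure r), 0 ≤ y := by
  rw [ae_iff]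
  have : {a : ℝ | ¬ 0 ≤ a} = Set.Iio 0 := by ext; simp
  rw [this]
  refine (withDensity_apply _ measurableSet_Iio).trans ?_
  exact lintegral_gammaPDF_of_nonpos le_rfl

open ProbabilityTheory in
lemma aux_lintegral_id {r : ℝ} (hr : 0 < r) :
    ∫⁻ y, ENNReal.ofReal y ∂(expMeasure r) = ENNReal.ofReal (1 / r) := by
  have hmeas : Measurable (gammaPDF 1 r) := (measurable_gammaPDFReal 1 r).ennreal_ofReal
  have h : ∫⁻ y, ENNReal.ofReal y ∂(expMeasure r)
      = ∫⁻ y, ENNReal.ofReal (1 / r) * gammaPDF 2 r y := by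
    unfold expMeasure gammaMeasure
    rw [lintegral_withDensity_eq_lintegral_mul _ hmeas (by fun_prop)]
    congr 1
    ext y
    simp only [Pi.mul_apply]
    by_cases hy : 0 ≤ y
    · rw [gammaPDF_of_nonneg hy, gammaPDF_of_nonneg hy, ← ENNReal.ofReal_mul (by positivity),
        ← ENNReal.ofReal_mul (by positivity)]
      congr 1
      have : Real.Gamma 2 = 1 := Real.Gamma_two
      rw [this, Real.Gamma_one]
      norm_num
      field_simp
    · rw [gammaPDF_of_neg (not_le.mp hy), gammaPDF_of_neg (not_le.mp hy)]; simp
  rw [h, lintegral_const_mul' _ _ ENNReal.ofReal_ne_top, lintegral_gammaPDF_eq_one two_pos hr,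
    mul_one]

open ProbabilityTheory in
lemma aux_mean_one {r : ℝ} (hr : 0 < r) :
    Integrable (fun y : ℝ => y) (expMeasure r) ∧ ∫ y, y ∂(expMeasure r) = 1 / r := by
  have h0 := aux_ae_nonneg_one r
  have h1 := aux_lintegral_id hr
  have hm : AEStronglyMeasurable (fun y : ℝ => y) (expMeasure r) :=
    measurable_id.aestronglyMeasurable
  constructor
  · refine ⟨hm, ?_⟩
    rw [hasFiniteIntegral_iff_ofReal h0, h1]
    exact ENNReal.ofReal_lt_top
  · rw [integral_eq_lintegral_of_nonneg_ae h0 hm, h1, ENNReal.toReal_ofReal (by positivity)]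

lemma aux_isProb {N : ℕ} {ν : ℝ} (hν : 0 < ν) : IsProbabilityMeasure (expPi N ν) := by
  have := ProbabilityTheory.isProbabilityMeasure_expMeasure hν
  unfold expPi; infer_instance

lemma aux_ae_nonneg {N : ℕ} {ν : ℝ} (hν : 0 < ν) : ∀ᵐ σ ∂(expPi N ν), ∀ i, 0 ≤ σ i := by
  have := ProbabilityTheory.isProbabilityMeasure_expMeasure hν
  rw [ae_all_iff]
  intro i
  exact (measurePreserving_eval (fun _ : Fin N => ProbabilityTheory.expMeasure ν)
    i).quasiMeasurePreserving.ae (aux_ae_nonneg_one ν)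

lemma aux_mean {N : ℕ} {ν : ℝ} (hν : 0 < ν) (i : Fin N) :
    Integrable (fun σ : Fin N → ℝ => σ i) (expPi N ν) ∧ ∫ σ, σ i ∂(expPi N ν) = 1 / ν := by
  have := ProbabilityTheory.isProbabilityMeasure_expMeasure hν
  refine ⟨integrable_comp_eval (μ := fun _ : Fin N => ProbabilityTheory.expMeasure ν) (i := i)
    (aux_mean_one hν).1, ?_⟩
  rw [← (aux_mean_one hν).2]
  exact integral_comp_eval (μ := fun _ : Fin N => ProbabilityTheory.expMeasure ν) (i := i)
    (aux_mean_one hν).1.1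

/-- Memorylessness of the product exponential law, in the direction `i`. -/
lemma aux_shift_measure {N : ℕ} {ν c : ℝ} (hν : 0 < ν) (hc : 0 ≤ c) (i : Fin N) :
    ENNReal.ofReal (Real.exp (-(ν * c))) •
        (expPi N ν).map (fun σ j => σ j + if j = i then c else 0)
      = (expPi N ν).restrict (Set.univ.pi fun j => if j = i then Set.Ici c else Set.univ) := by
  have := ProbabilityTheory.isProbabilityMeasure_expMeasure hν
  have hT : Measurable (fun (σ : Fin N → ℝ) j => σ j + if j = i then c else 0) := by fun_prop
  unfold expPi
  rw [Measure.restrict_pi_pi]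
  symm
  refine Measure.pi_eq fun s hs => ?_
  rw [Measure.smul_apply, Measure.map_apply hT (.univ_pi hs), smul_eq_mul]
  have : (fun (σ : Fin N → ℝ) j => σ j + if j = i then c else 0) ⁻¹' (Set.univ.pi s)
      = Set.univ.pi (fun j => (fun y => y + if j = i then c else 0) ⁻¹' (s j)) := by
    ext; simp
  rw [this, Measure.pi_pi, ← Finset.mul_prod_erase _ _ (Finset.mem_univ i),
    ← Finset.mul_prod_erase Finset.univ
      (fun j => ((ProbabilityTheory.expMeasure ν).restrict _) (s j)) (Finset.mem_univ i),
    ← mul_assoc]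
  congr 1
  · rw [Measure.restrict_apply (hs i)]
    simpa using aux_memoryless hc (hs i)
  · refine Finset.prod_congr rfl fun j hj => ?_
    have hji : j ≠ i := Finset.ne_of_mem_erase hj
    simp [hji]

lemma aux_shift {N : ℕ} {ν c : ℝ} (hν : 0 < ν) (hc : 0 ≤ c) (i : Fin N)
    (h : (Fin N → ℝ) → ℝ) (hm : Measurable h) (hint : Integrable h (expPi N ν))
    (h0 : ∀ σ : Fin N → ℝ, (∀ j, 0 ≤ σ j) → 0 ≤ h σ) :
    Real.exp (-(ν * c)) * ∫ σ, h (fun j => σ j + if j = i then c else 0) ∂(expPi N ν)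
      ≤ ∫ σ, h σ ∂(expPi N ν) := by
  have hT : Measurable (fun (σ : Fin N → ℝ) j => σ j + if j = i then c else 0) := by fun_prop
  have e : Real.exp (-(ν * c)) * ∫ σ, h (fun j => σ j + if j = i then c else 0) ∂(expPi N ν)
      = ∫ σ in (Set.univ.pi fun j => if j = i then Set.Ici c else Set.univ), h σ ∂(expPi N ν) := by
    rw [← aux_shift_measure hν hc i, integral_smul_measure,
      integral_map hT.aemeasurable hm.aestronglyMeasurable,
      ENNReal.toReal_ofReal (Real.exp_pos _).le, smul_eq_mul]
  rw [e]
  refine setIntegral_le_integral hint ?_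
  filter_upwards [aux_ae_nonneg hν] with σ hσ using h0 σ hσ

lemma aux_simplex_le_one {N : ℕ} {y : Fin N → ℝ} (hy : y ∈ stdSimplex ℝ (Fin N)) (i : Fin N) :
    y i ≤ 1 := by
  rw [← hy.2]
  exact Finset.single_le_sum (f := y) (fun j _ => hy.1 j) (Finset.mem_univ i)

lemma aux_integrable_coord {N : ℕ} {ν : ℝ} (hν : 0 < ν) (x : (Fin N → ℝ) → (Fin N → ℝ))
    (hm : Measurable x)
    (hs : ∀ σ : Fin N → ℝ, (∀ i, 0 ≤ σ i) → x σ ∈ stdSimplex ℝ (Fin N)) (i : Fin N) :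
    Integrable (fun σ => x σ i) (expPi N ν) := by
  have := aux_isProb (N := N) hν
  refine Integrable.of_bound (C := 1) (by fun_prop) ?_
  filter_upwards [aux_ae_nonneg hν] with σ hσ
  rw [Real.norm_eq_abs, abs_of_nonneg ((hs σ hσ).1 i)]
  exact aux_simplex_le_one (hs σ hσ) i

lemma aux_integrable_dist {N : ℕ} {ν : ℝ} (hν : 0 < ν) (x x' : (Fin N → ℝ) → (Fin N → ℝ))
    (hm : Measurable x) (hm' : Measurable x')
    (hs : ∀ σ : Fin N → ℝ, (∀ i, 0 ≤ σ i) → x σ ∈ stdSimplex ℝ (Fin N))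
    (hs' : ∀ σ : Fin N → ℝ, (∀ i, 0 ≤ σ i) → x' σ ∈ stdSimplex ℝ (Fin N)) :
    Integrable (fun σ => ∑ i, |x σ i - x' σ i|) (expPi N ν) :=
  integrable_finsetSum _ fun i _ =>
    ((aux_integrable_coord hν x hm hs i).sub (aux_integrable_coord hν x' hm' hs' i)).abs

lemma aux_mono {N : ℕ} {ε l c : ℝ} (hε : 0 ≤ ε) (hc : 0 < c)
    (F F' : (Fin N → ℝ) → ℝ) (i : Fin N) (σ : Fin N → ℝ)
    (x x' y : Fin N → ℝ)
    (hl : |F' x - F x - (F' x' - F x')| ≤ l * ∑ i, |x i - x' i|)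
    (h1 : F y + ∑ j, σ j * y j - ε ≤ F x + ∑ j, σ j * x j)
    (h2 : F' x + ∑ j, σ j * x j - ε ≤ F' x' + ∑ j, σ j * x' j)
    (h3 : F x + ∑ j, (σ j + if j = i then c else 0) * x j - ε
      ≤ F y + ∑ j, (σ j + if j = i then c else 0) * y j)
    (h4 : F x' + ∑ j, (σ j + if j = i then c else 0) * x' j - ε
      ≤ F y + ∑ j, (σ j + if j = i then c else 0) * y j) :
    max (x i) (x' i) - (l * (∑ i, |x i - x' i|) + 3 * ε) / c ≤ y i := by
  have e : ∀ w : Fin N → ℝ, ∑ j, (σ j + if j = i then c else 0) * w j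
      = ∑ j, σ j * w j + c * w i := by
    intro w
    simp [add_mul, Finset.sum_add_distrib]
  rw [e, e] at h3 h4
  have hD := (abs_nonneg _).trans hl
  rw [sub_le_iff_le_add, max_le_iff]
  have h5 := abs_le.mp hl
  rw [← sub_le_iff_le_add', ← sub_le_iff_le_add', le_div_iff₀ hc, le_div_iff₀ hc]
  constructor <;> nlinarith [h5.1, h5.2]

/-- Stability of (approximate) perturbed leaders. -/
lemma aux_stab {N : ℕ} (hN : 0 < N) {ν ε l : ℝ} (hν : 0 < ν) (hε : 0 ≤ ε) (hl0 : 0 < l)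
    (F F' : (Fin N → ℝ) → ℝ)
    (hl : ∀ y ∈ stdSimplex ℝ (Fin N), ∀ y' ∈ stdSimplex ℝ (Fin N),
      |F' y - F y - (F' y' - F y')| ≤ l * ∑ i, |y i - y' i|)
    (x x' : (Fin N → ℝ) → (Fin N → ℝ)) (hm : Measurable x) (hm' : Measurable x')
    (hs : ∀ σ : Fin N → ℝ, (∀ i, 0 ≤ σ i) → x σ ∈ stdSimplex ℝ (Fin N))
    (hs' : ∀ σ : Fin N → ℝ, (∀ i, 0 ≤ σ i) → x' σ ∈ stdSimplex ℝ (Fin N))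
    (ho : ∀ σ : Fin N → ℝ, (∀ i, 0 ≤ σ i) → ∀ y ∈ stdSimplex ℝ (Fin N),
      F y + ∑ j, σ j * y j - ε ≤ F (x σ) + ∑ j, σ j * x σ j)
    (ho' : ∀ σ : Fin N → ℝ, (∀ i, 0 ≤ σ i) → ∀ y ∈ stdSimplex ℝ (Fin N),
      F' y + ∑ j, σ j * y j - ε ≤ F' (x' σ) + ∑ j, σ j * x' σ j) :
    ∫ σ, ∑ i, |x σ i - x' σ i| ∂(expPi N ν) ≤ 8 * ν * N * l + 3 * ε / l := by
  have := aux_isProb (N := N) hν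
  have hNr : (0 : ℝ) < N := by exact_mod_cast hN
  set c : ℝ := 2 * N * l with hcdef
  have hc : 0 < c := by positivity
  have hi := aux_integrable_coord hν x hm hs
  have hi' := aux_integrable_coord hν x' hm' hs'
  have hiD := aux_integrable_dist hν x x' hm hm' hs hs'
  set D := ∫ σ, ∑ i, |x σ i - x' σ i| ∂(expPi N ν) with hDdef
  have hD0 : 0 ≤ D := integral_nonneg fun σ => Finset.sum_nonneg fun i _ => abs_nonneg _
  have hmin : ∀ i, Integrable (fun σ => min (x σ i) (x' σ i)) (expPi N ν) :=
    fun i => (hi i).inf (hi' i)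
  have hmax : ∀ i, Integrable (fun σ => max (x σ i) (x' σ i)) (expPi N ν) :=
    fun i => (hi i).sup (hi' i)
  have key : ∀ i, ∫ σ, |x σ i - x' σ i| ∂(expPi N ν)
      ≤ ν * c * (∫ σ, max (x σ i) (x' σ i) ∂(expPi N ν)) + (l * D + 3 * ε) / c := by
    intro i
    have hmm : Measurable (fun σ => min (x σ i) (x' σ i)) := by fun_prop
    have h1 := aux_shift hν hc.le i _ hmm (hmin i)
      (fun σ hσ => le_min ((hs σ hσ).1 i) ((hs' σ hσ).1 i))
    set T : (Fin N → ℝ) → (Fin N → ℝ) := fun σ j => σ j + if j = i then c else 0 with hT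
    have hTm : Measurable T := by rw [hT]; fun_prop
    have hT0 : ∀ σ : Fin N → ℝ, (∀ j, 0 ≤ σ j) → ∀ j, 0 ≤ T σ j := by
      intro σ hσ j
      simp only [hT]
      have := hσ j
      split_ifs <;> linarith
    have h2 : ∫ σ, (max (x σ i) (x' σ i) - (l * (∑ i, |x σ i - x' σ i|) + 3 * ε) / c) ∂(expPi N ν)
        ≤ ∫ σ, min (x (T σ) i) (x' (T σ) i) ∂(expPi N ν) := by
      refine integral_mono_ae ?_ ?_ ?_
      · exact (hmax i).sub (((hiD.const_mul l).add (integrable_const _)).div_const c)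
      · refine Integrable.inf ?_ ?_
        · exact aux_integrable_coord hν (fun σ => x (T σ)) (hm.comp hTm)
            (fun σ hσ => hs _ (hT0 σ hσ)) i
        · exact aux_integrable_coord hν (fun σ => x' (T σ)) (hm'.comp hTm)
            (fun σ hσ => hs' _ (hT0 σ hσ)) i
      · filter_upwards [aux_ae_nonneg hν] with σ hσ
        have hσT := hT0 σ hσ
        refine le_min ?_ ?_
        · exact aux_mono hε hc F F' i σ (x σ) (x' σ) (x (T σ))
            (hl _ (hs σ hσ) _ (hs' σ hσ))
            (ho σ hσ _ (hs _ hσT)) (ho' σ hσ _ (hs _ hσ))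
            (ho _ hσT _ (hs _ hσ)) (ho _ hσT _ (hs' _ hσ))
        · have h := aux_mono (l := l) hε hc F' F i σ (x' σ) (x σ) (x' (T σ))
            (by
              have := hl _ (hs σ hσ) _ (hs' σ hσ)
              have e : F (x' σ) - F' (x' σ) - (F (x σ) - F' (x σ))
                = F' (x σ) - F (x σ) - (F' (x' σ) - F (x' σ)) := by ring
              rw [e]
              simpa only [abs_sub_comm] using this)
            (ho' σ hσ _ (hs' _ hσT)) (ho σ hσ _ (hs' _ hσ))
            (ho' _ hσT _ (hs' _ hσ)) (ho' _ hσT _ (hs _ hσ))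
          rw [max_comm] at h
          have e : ∑ i, |x' σ i - x σ i| = ∑ i, |x σ i - x' σ i| :=
            Finset.sum_congr rfl fun i _ => abs_sub_comm _ _
          rwa [e] at h
    have hq : Integrable (fun σ => (l * (∑ i, |x σ i - x' σ i|) + 3 * ε) / c) (expPi N ν) :=
      ((hiD.const_mul l).add (integrable_const _)).div_const c
    rw [integral_sub (hmax i) hq,
      integral_div, integral_add (hiD.const_mul l) (integrable_const _), integral_const_mul,
      ← hDdef] at h2
    simp only [integral_const, probReal_univ, one_smul] at h2
    have h3 : ∫ σ, |x σ i - x' σ i| ∂(expPi N ν)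
        = ∫ σ, max (x σ i) (x' σ i) ∂(expPi N ν) - ∫ σ, min (x σ i) (x' σ i) ∂(expPi N ν) := by
      rw [← integral_sub (hmax i) (hmin i)]
      congr 1
      ext σ
      rw [max_sub_min_eq_abs, abs_sub_comm]
    set A := ∫ σ, max (x σ i) (x' σ i) ∂(expPi N ν)
    have hA : 0 ≤ A := by
      refine integral_nonneg_of_ae ?_
      filter_upwards [aux_ae_nonneg hν] with σ hσ
      exact le_max_of_le_left ((hs σ hσ).1 i)
    set B := (l * D + 3 * ε) / c
    have hB : 0 ≤ B := by positivity
    have he : 1 - ν * c ≤ Real.exp (-(ν * c)) := by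
      have := Real.add_one_le_exp (-(ν * c)); linarith
    have he1 : Real.exp (-(ν * c)) ≤ 1 := Real.exp_le_one_iff.mpr (by
      have : 0 < ν * c := by positivity
      linarith)
    have he0 := Real.exp_pos (-(ν * c))
    have h4 := mul_le_mul_of_nonneg_left h2 he0.le
    rw [h3]
    nlinarith [mul_nonneg hA (sub_nonneg.mpr he), mul_nonneg hB (sub_nonneg.mpr he1)]
  have hsum : D ≤ ν * c * 2 + N * ((l * D + 3 * ε) / c) := by
    have e1 : D = ∑ i, ∫ σ, |x σ i - x' σ i| ∂(expPi N ν) :=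
      integral_finsetSum _ fun i _ => ((hi i).sub (hi' i)).abs
    have e2 : ∑ i, ∫ σ, max (x σ i) (x' σ i) ∂(expPi N ν) ≤ 2 := by
      rw [← integral_finsetSum _ fun i _ => hmax i]
      have : ∫ σ, ∑ i, max (x σ i) (x' σ i) ∂(expPi N ν) ≤ ∫ σ, (2 : ℝ) ∂(expPi N ν) := by
        refine integral_mono_ae (integrable_finsetSum _ fun i _ => hmax i)
          (integrable_const _) ?_
        filter_upwards [aux_ae_nonneg hν] with σ hσ
        calc ∑ i, max (x σ i) (x' σ i) ≤ ∑ i, (x σ i + x' σ i) := by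
              refine Finset.sum_le_sum fun i _ => max_le ?_ ?_
              · linarith [(hs' σ hσ).1 i]
              · linarith [(hs σ hσ).1 i]
          _ = 2 := by rw [Finset.sum_add_distrib, (hs σ hσ).2, (hs' σ hσ).2]; norm_num
      simpa using this
    calc D = ∑ i, ∫ σ, |x σ i - x' σ i| ∂(expPi N ν) := e1
      _ ≤ ∑ i : Fin N, (ν * c * (∫ σ, max (x σ i) (x' σ i) ∂(expPi N ν)) + (l * D + 3 * ε) / c) :=
          Finset.sum_le_sum fun i _ => key i
      _ = ν * c * (∑ i, ∫ σ, max (x σ i) (x' σ i) ∂(expPi N ν)) + N * ((l * D + 3 * ε) / c) := by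
          rw [Finset.sum_add_distrib, ← Finset.mul_sum]; simp
      _ ≤ _ := by
          have : 0 ≤ ν * c := by positivity
          nlinarith
  have e3 : N * ((l * D + 3 * ε) / c) = D / 2 + 3 * ε / l / 2 := by
    rw [hcdef]; field_simp
  rw [e3, hcdef] at hsum
  linarith

lemma aux_bdd {N M : ℕ} (A : Matrix (Fin N) (Fin M) ℝ) :
    BddAbove {r : ℝ | ∃ u : Fin M → ℝ, (∑ j, |u j|) = 1 ∧ r = ∑ i, |A.mulVec u i|} := by
  refine ⟨∑ i, ∑ j, |A i j|, ?_⟩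
  rintro r ⟨u, hu, rfl⟩
  refine Finset.sum_le_sum fun i _ => ?_
  rw [Matrix.mulVec, dotProduct]
  refine (Finset.abs_sum_le_sum_abs _ _).trans (Finset.sum_le_sum fun j _ => ?_)
  rw [abs_mul]
  have : |u j| ≤ 1 := by
    rw [← hu]; exact Finset.single_le_sum (f := fun j => |u j|) (fun _ _ => abs_nonneg _)
      (Finset.mem_univ j)
  exact mul_le_of_le_one_right (abs_nonneg _) this

lemma aux_entry_le {N M : ℕ} (A : Matrix (Fin N) (Fin M) ℝ) (i : Fin N) (j : Fin M) :
    |A i j| ≤ l1OpNorm A := by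
  have h : ∑ i, |A i j| ≤ l1OpNorm A := by
    refine le_csSup (aux_bdd A) ⟨Pi.single j 1, ?_, ?_⟩
    · rw [Finset.sum_eq_single j] <;> simp +contextual
    · simp
  exact (Finset.single_le_sum (f := fun i => |A i j|) (fun _ _ => abs_nonneg _)
      (Finset.mem_univ i)).trans h

lemma aux_norm_nonneg {N M : ℕ} (A : Matrix (Fin N) (Fin M) ℝ) : 0 ≤ l1OpNorm A := by
  refine Real.sSup_nonneg ?_
  rintro r ⟨u, hu, rfl⟩
  exact Finset.sum_nonneg fun _ _ => abs_nonneg _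

lemma aux_norm_pos {N M : ℕ} (A : Matrix (Fin N) (Fin M) ℝ) (hA : A ≠ 0) : 0 < l1OpNorm A := by
  by_contra h
  refine hA ?_
  ext i j
  have := (aux_entry_le A i j).trans (not_lt.mp h)
  simpa using abs_nonpos_iff.mp this

section softmax
variable {M : ℕ}

lemma aux_softmax (hM : 0 < M) (α β s : Fin M → ℝ) (C : ℝ) (hβ : ∀ j, |β j| ≤ C)
    (hs : ∀ j, |s j| ≤ 1) :
    |(∑ j, s j * Real.exp (α j + β j)) / (∑ j, Real.exp (α j + β j))
      - (∑ j, s j * Real.exp (α j)) / (∑ j, Real.exp (α j))| ≤ 2 * C := by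
  have hne : (Finset.univ : Finset (Fin M)).Nonempty := ⟨⟨0, hM⟩, Finset.mem_univ _⟩
  have hC : 0 ≤ C := (abs_nonneg _).trans (hβ ⟨0, hM⟩)
  have hB : ∀ t : ℝ, 0 < ∑ j, Real.exp (α j + t * β j) :=
    fun t => Finset.sum_pos (fun j _ => Real.exp_pos _) hne
  have hd : ∀ (w : Fin M → ℝ) (t : ℝ), HasDerivAt (fun t => ∑ j, w j * Real.exp (α j + t * β j))
      (∑ j, w j * (Real.exp (α j + t * β j) * β j)) t := by
    intro w t
    refine HasDerivAt.fun_sum fun j _ => HasDerivAt.const_mul _ ?_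
    have : HasDerivAt (fun t : ℝ => α j + t * β j) (β j) t := by
      simpa using ((hasDerivAt_id t).mul_const (β j)).const_add (α j)
    exact this.exp
  have hd1 : ∀ t : ℝ, HasDerivAt (fun t => ∑ j, Real.exp (α j + t * β j))
      (∑ j, (Real.exp (α j + t * β j) * β j)) t := by
    intro t; simpa using hd (fun _ => 1) t
  have bnd : ∀ (w : Fin M → ℝ) (c t : ℝ), (∀ j, |w j| ≤ c) →
      |∑ j, w j * Real.exp (α j + t * β j)| ≤ c * ∑ j, Real.exp (α j + t * β j) := by
    intro w c t hw
    refine (Finset.abs_sum_le_sum_abs _ _).trans ?_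
    rw [Finset.mul_sum]
    refine Finset.sum_le_sum fun j _ => ?_
    rw [abs_mul, abs_of_pos (Real.exp_pos _)]
    exact mul_le_mul_of_nonneg_right (hw j) (Real.exp_pos _).le
  have := norm_image_sub_le_of_norm_deriv_le_segment_01' (C := 2 * C)
    (f := fun t => (∑ j, s j * Real.exp (α j + t * β j)) / (∑ j, Real.exp (α j + t * β j)))
    (fun t _ => ((hd s t).fun_div (hd1 t) (hB t).ne').hasDerivWithinAt) (fun t _ => by
      have b1 := bnd s 1 t hs
      have b2 := bnd β C t hβ
      have b3 := bnd (fun j => s j * β j) C t (fun j => by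
        rw [abs_mul]
        calc |s j| * |β j| ≤ 1 * C := mul_le_mul (hs j) (hβ j) (abs_nonneg _) zero_le_one
          _ = C := one_mul _)
      have e2 : ∑ j, Real.exp (α j + t * β j) * β j = ∑ j, β j * Real.exp (α j + t * β j) :=
        Finset.sum_congr rfl fun j _ => mul_comm _ _
      have e3 : ∑ j, s j * (Real.exp (α j + t * β j) * β j)
          = ∑ j, s j * β j * Real.exp (α j + t * β j) :=
        Finset.sum_congr rfl fun j _ => by ring
      rw [e2, e3]
      have hBt := hB t
      set B := ∑ j, Real.exp (α j + t * β j)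
      set X := ∑ j, s j * Real.exp (α j + t * β j)
      set Y := ∑ j, β j * Real.exp (α j + t * β j)
      set Z := ∑ j, s j * β j * Real.exp (α j + t * β j)
      rw [Real.norm_eq_abs, abs_div, abs_of_pos (pow_pos hBt 2), div_le_iff₀ (pow_pos hBt 2)]
      calc |Z * B - X * Y| ≤ |Z * B| + |X * Y| := abs_sub _ _
        _ = |Z| * B + |X| * |Y| := by rw [abs_mul, abs_mul, abs_of_pos hBt]
        _ ≤ C * B * B + (1 * B) * (C * B) := by
            refine add_le_add (mul_le_mul_of_nonneg_right b3 hBt.le) ?_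
            exact mul_le_mul b1 b2 (abs_nonneg _) (by linarith)
        _ = 2 * C * B ^ 2 := by ring)
  simpa using this

end softmax

lemma aux_qr_sum {N M : ℕ} (hM : 0 < M) (η : ℝ) (V : Matrix (Fin N) (Fin M) ℝ) (z : Fin N → ℝ) :
    ∑ j, qr η V z j = 1 := by
  have hne : (Finset.univ : Finset (Fin M)).Nonempty := ⟨⟨0, hM⟩, Finset.mem_univ _⟩
  unfold qr
  rw [← Finset.sum_div]
  exact div_self (Finset.sum_pos (fun j _ => Real.exp_pos _) hne).ne'

lemma aux_qr_nonneg {N M : ℕ} (η : ℝ) (V : Matrix (Fin N) (Fin M) ℝ) (z : Fin N → ℝ)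
    (j : Fin M) : 0 ≤ qr η V z j :=
  div_nonneg (Real.exp_pos _).le (Finset.sum_nonneg fun _ _ => (Real.exp_pos _).le)

lemma aux_qr_lip {N M : ℕ} (hM : 0 < M) {η : ℝ} (hη : 0 < η) (V : Matrix (Fin N) (Fin M) ℝ)
    (z z' : Fin N → ℝ) :
    ∑ j, |qr η V z j - qr η V z' j| ≤ 2 * η * l1OpNorm V * ∑ n, |z n - z' n| := by
  set s : Fin M → ℝ := fun j => SignType.sign (qr η V z j - qr η V z' j) with hsdef
  have hs : ∀ j, |s j| ≤ 1 := by
    intro j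
    simp only [hsdef]
    rcases SignType.sign (qr η V z j - qr η V z' j) with _ | _ | _ <;> simp
  have h := aux_softmax hM (fun j => η * ∑ n, V n j * z' n)
    (fun j => η * ∑ n, V n j * (z n - z' n)) s (η * (l1OpNorm V * ∑ n, |z n - z' n|))
    (fun j => by
      rw [abs_mul, abs_of_pos hη]
      refine mul_le_mul_of_nonneg_left ?_ hη.le
      refine (Finset.abs_sum_le_sum_abs _ _).trans ?_
      rw [Finset.mul_sum]
      refine Finset.sum_le_sum fun n _ => ?_
      rw [abs_mul]
      exact mul_le_mul_of_nonneg_right (aux_entry_le V n j) (abs_nonneg _)) hs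
  have e : ∀ j, η * ∑ n, V n j * z' n + η * ∑ n, V n j * (z n - z' n)
      = η * ∑ n, V n j * z n := by
    intro j
    rw [← mul_add, ← Finset.sum_add_distrib]
    congr 1
    exact Finset.sum_congr rfl fun n _ => by ring
  simp only [e] at h
  have e2 : ∑ j, |qr η V z j - qr η V z' j|
      = (∑ j, s j * Real.exp (η * ∑ n, V n j * z n)) / (∑ j, Real.exp (η * ∑ n, V n j * z n))
      - (∑ j, s j * Real.exp (η * ∑ n, V n j * z' n))
        / (∑ j, Real.exp (η * ∑ n, V n j * z' n)) := by
    rw [Finset.sum_div, Finset.sum_div, ← Finset.sum_sub_distrib]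
    refine Finset.sum_congr rfl fun j _ => ?_
    rw [mul_div_assoc, mul_div_assoc, ← mul_sub]
    exact (sign_mul_self _).symm
  rw [e2]
  refine (le_abs_self _).trans (h.trans (le_of_eq (by ring)))

lemma aux_Uq {N M : ℕ} (U : Matrix (Fin N) (Fin M) ℝ) (i : Fin N) (w : Fin M → ℝ) :
    |∑ j, U i j * w j| ≤ l1OpNorm U * ∑ j, |w j| := by
  refine (Finset.abs_sum_le_sum_abs _ _).trans ?_
  rw [Finset.mul_sum]
  refine Finset.sum_le_sum fun n _ => ?_
  rw [abs_mul]
  exact mul_le_mul_of_nonneg_right (aux_entry_le U i n) (abs_nonneg _)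

lemma aux_payoff_single {N M K : ℕ} (η : ℝ) (U : Matrix (Fin N) (Fin M) ℝ)
    (V : Fin K → Matrix (Fin N) (Fin M) ℝ) (z x : Fin N → ℝ) (k : Fin K) :
    qrPayoff η U V z x (Pi.single k 1) = ∑ i, x i * ∑ j, U i j * qr η (V k) z j := by
  unfold qrPayoff
  rw [Finset.sum_eq_single k] <;> simp +contextual

lemma aux_payoff_sum {N M K : ℕ} (η : ℝ) (U : Matrix (Fin N) (Fin M) ℝ)
    (V : Fin K → Matrix (Fin N) (Fin M) ℝ) (z x : Fin N → ℝ) (g : ℕ → Fin K → ℝ)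
    (S : Finset ℕ) :
    qrPayoff η U V z x (∑ τ ∈ S, g τ) = ∑ τ ∈ S, qrPayoff η U V z x (g τ) := by
  unfold qrPayoff
  rw [Finset.sum_comm]
  refine Finset.sum_congr rfl fun k _ => ?_
  rw [Finset.sum_apply, Finset.sum_mul]

lemma aux_Uqr_le {N M : ℕ} (hM : 0 < M) (η : ℝ) (U : Matrix (Fin N) (Fin M) ℝ)
    (V : Matrix (Fin N) (Fin M) ℝ) (z : Fin N → ℝ) (i : Fin N) :
    |∑ j, U i j * qr η V z j| ≤ l1OpNorm U := by
  refine (aux_Uq U i _).trans (le_of_eq ?_)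
  have : ∑ j, |qr η V z j| = 1 := by
    rw [← aux_qr_sum hM η V z]
    exact Finset.sum_congr rfl fun j _ => abs_of_nonneg (aux_qr_nonneg _ _ _ _)
  rw [this, mul_one]

lemma aux_payoff_bounds {N M K : ℕ} (hM : 0 < M) (η : ℝ) (U : Matrix (Fin N) (Fin M) ℝ)
    (hU : ∀ i j, 0 ≤ U i j)
    (V : Fin K → Matrix (Fin N) (Fin M) ℝ) (z x : Fin N → ℝ) (hx : x ∈ stdSimplex ℝ (Fin N))
    (k : Fin K) :
    0 ≤ qrPayoff η U V z x (Pi.single k 1) ∧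
      qrPayoff η U V z x (Pi.single k 1) ≤ l1OpNorm U := by
  rw [aux_payoff_single]
  constructor
  · exact Finset.sum_nonneg fun i _ => mul_nonneg (hx.1 i)
      (Finset.sum_nonneg fun j _ => mul_nonneg (hU i j) (aux_qr_nonneg _ _ _ _))
  · calc ∑ i, x i * ∑ j, U i j * qr η (V k) z j ≤ ∑ i, x i * l1OpNorm U :=
        Finset.sum_le_sum fun i _ => mul_le_mul_of_nonneg_left
          ((le_abs_self _).trans (aux_Uqr_le hM η U (V k) z i)) (hx.1 i)
      _ = l1OpNorm U := by rw [← Finset.sum_mul, hx.2, one_mul]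

/-- Lipschitz continuity in the reputation argument. -/
lemma aux_payoff_lip_left {N M K : ℕ} (hM : 0 < M) {η : ℝ} (hη : 0 < η)
    (U : Matrix (Fin N) (Fin M) ℝ)
    (V : Fin K → Matrix (Fin N) (Fin M) ℝ) (z z' x : Fin N → ℝ) (hx : x ∈ stdSimplex ℝ (Fin N))
    (k : Fin K) (L : ℝ) (hL : 2 * η * l1OpNorm (V k) ≤ L) :
    |qrPayoff η U V z x (Pi.single k 1) - qrPayoff η U V z' x (Pi.single k 1)|
      ≤ l1OpNorm U * L * ∑ i, |z i - z' i| := by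
  rw [aux_payoff_single, aux_payoff_single, ← Finset.sum_sub_distrib]
  refine (Finset.abs_sum_le_sum_abs _ _).trans ?_
  have hq := (aux_qr_lip hM hη (V k) z z').trans
    (mul_le_mul_of_nonneg_right hL (Finset.sum_nonneg fun _ _ => abs_nonneg _))
  calc ∑ i, |x i * ∑ j, U i j * qr η (V k) z j - x i * ∑ j, U i j * qr η (V k) z' j|
      ≤ ∑ i, x i * (l1OpNorm U * (L * ∑ i, |z i - z' i|)) := by
        refine Finset.sum_le_sum fun i _ => ?_
        rw [← mul_sub, abs_mul, abs_of_nonneg (hx.1 i), ← Finset.sum_sub_distrib]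
        refine mul_le_mul_of_nonneg_left ?_ (hx.1 i)
        simp only [← mul_sub]
        exact (aux_Uq U i _).trans (mul_le_mul_of_nonneg_left hq (aux_norm_nonneg U))
    _ = _ := by rw [← Finset.sum_mul, hx.2]; ring

/-- Lipschitz continuity in the strategy argument. -/
lemma aux_payoff_lip_right {N M K : ℕ} (hM : 0 < M) (η : ℝ)
    (U : Matrix (Fin N) (Fin M) ℝ)
    (V : Fin K → Matrix (Fin N) (Fin M) ℝ) (z x x' : Fin N → ℝ) (k : Fin K) :
    |qrPayoff η U V z x (Pi.single k 1) - qrPayoff η U V z x' (Pi.single k 1)|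
      ≤ l1OpNorm U * ∑ i, |x i - x' i| := by
  rw [aux_payoff_single, aux_payoff_single, ← Finset.sum_sub_distrib, Finset.mul_sum]
  refine (Finset.abs_sum_le_sum_abs _ _).trans (Finset.sum_le_sum fun i _ => ?_)
  rw [← sub_mul, abs_mul, mul_comm]
  exact mul_le_mul_of_nonneg_right (aux_Uqr_le hM η U (V k) z i) (abs_nonneg _)

lemma aux_payoff_lip {N M K : ℕ} (hM : 0 < M) {η : ℝ} (hη : 0 < η)
    (U : Matrix (Fin N) (Fin M) ℝ)
    (V : Fin K → Matrix (Fin N) (Fin M) ℝ) (y y' : Fin N → ℝ) (hy : y' ∈ stdSimplex ℝ (Fin N))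
    (k : Fin K) (L : ℝ) (hL : 2 * η * l1OpNorm (V k) ≤ L) :
    |qrPayoff η U V y y (Pi.single k 1) - qrPayoff η U V y' y' (Pi.single k 1)|
      ≤ l1OpNorm U * (1 + L) * ∑ i, |y i - y' i| := by
  have h1 := aux_payoff_lip_left hM hη U V y y' y' hy k L hL
  have h2 := aux_payoff_lip_right hM η U V y y y' k
  refine (abs_sub_le _ (qrPayoff η U V y y' (Pi.single k 1)) _).trans ?_
  linarith

lemma aux_reflect (a : ℕ → ℝ) (f : ℕ → ℝ) (t : ℕ) :
    ∑ τ ∈ Finset.range (t + 1), a (t - τ) * f (t - τ) = ∑ s ∈ Finset.range (t + 1), a s * f s := by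
  have := Finset.sum_range_reflect (fun s => a s * f s) (t + 1)
  simpa using this

lemma aux_memB_pos (a : ℕ → ℝ) (ha : ∀ s, 0 ≤ a s) (ha0 : 0 < a 0) (t : ℕ) :
    0 < memB a (t + 1) := by
  unfold memB
  rw [Finset.sum_range_succ']
  have : 0 ≤ ∑ k ∈ Finset.range t, a (k + 1) := Finset.sum_nonneg fun _ _ => ha _
  linarith

lemma aux_memTheta_nonneg (a : ℕ → ℝ) (ha : ∀ s, 0 ≤ a s) (ha0 : 0 < a 0) (t : ℕ) :
    0 ≤ memTheta a (t + 1) :=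
  mul_nonneg (inv_nonneg.mpr (aux_memB_pos a ha ha0 t).le)
    (Finset.sum_nonneg fun _ _ => mul_nonneg (ha _) (Nat.cast_nonneg _))

lemma aux_reput {N : ℕ} (a : ℕ → ℝ) (ha : ∀ s, 0 ≤ a s) (ha0 : 0 < a 0)
    (x : ℕ → Fin N → ℝ) (t : ℕ) :
    ∑ i, |x t i - reput a x t i|
      ≤ (memB a (t + 1))⁻¹ * ∑ τ ∈ Finset.range (t + 1), a (t - τ) * ∑ i, |x τ i - x t i| := by
  have hb := aux_memB_pos a ha ha0 t
  have hbe : ∑ τ ∈ Finset.range (t + 1), a (t - τ) = memB a (t + 1) := by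
    simpa [memB] using aux_reflect a (fun _ => 1) t
  have e : ∀ i, x t i - reput a x t i
      = (memB a (t + 1))⁻¹ * ∑ τ ∈ Finset.range (t + 1), a (t - τ) * (x t i - x τ i) := by
    intro i
    simp only [reput, Pi.smul_apply, Finset.sum_apply, smul_eq_mul, mul_sub,
      Finset.sum_sub_distrib]
    rw [← Finset.sum_mul, hbe, ← mul_assoc, inv_mul_cancel₀ hb.ne', one_mul]
  calc ∑ i, |x t i - reput a x t i|
      ≤ ∑ i, (memB a (t + 1))⁻¹ * ∑ τ ∈ Finset.range (t + 1), a (t - τ) * |x τ i - x t i| := by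
        refine Finset.sum_le_sum fun i _ => ?_
        rw [e, abs_mul, abs_of_pos (inv_pos.mpr hb)]
        refine mul_le_mul_of_nonneg_left ?_ (inv_pos.mpr hb).le
        refine (Finset.abs_sum_le_sum_abs _ _).trans (Finset.sum_le_sum fun τ _ => ?_)
        rw [abs_mul, abs_of_nonneg (ha _), abs_sub_comm]
    _ = _ := by
        rw [← Finset.mul_sum, Finset.sum_comm]
        simp only [Finset.mul_sum]

lemma aux_final {n : ℕ} {N u L ν R ε Θ Θbar Λ : ℝ} (hN : 1 ≤ N) (hu : 0 < u) (hL : 0 ≤ L)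
    (hε : 0 ≤ ε) (hΘ0 : 0 ≤ Θ) (hΘ : Θ ≤ Θbar) (hΛ : Λ = u * (1 + L))
    (hR : R = Real.sqrt (50 * N * (Θbar + (n + 1)))) (hν : ν = (Λ * R)⁻¹) :
    N * (1 / ν) + u + n * ε + Λ * (n * (8 * ν * N * Λ + 3 * ε / Λ))
      + u * L * (8 * ν * N * Λ * Θ + (n + 1) * (3 * ε / Λ))
    ≤ 2 * N * Λ * R + ε * (13 * (n + 1) + 1) := by
  have hn : (0 : ℝ) ≤ n := Nat.cast_nonneg n
  have hΛ0 : 0 < Λ := by rw [hΛ]; positivity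
  have huL : u * L ≤ Λ := by rw [hΛ]; linarith
  have huΛ : u ≤ Λ := by rw [hΛ]; nlinarith
  have hS : 0 ≤ Θbar + (n + 1) := by linarith
  have hR2 : R ^ 2 = 50 * N * (Θbar + (n + 1)) := by rw [hR]; exact Real.sq_sqrt (by positivity)
  have hR7 : 7 ≤ R := by
    rw [hR]; refine Real.le_sqrt_of_sq_le ?_
    have : 1 * 1 ≤ N * (Θbar + (n + 1)) := mul_le_mul hN (by linarith) zero_le_one (by linarith)
    nlinarith
  have hR0 : 0 < R := by linarith
  have e1 : 1 / ν = Λ * R := by rw [hν]; simp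
  have e2 : Λ * (3 * ε / Λ) = 3 * ε := by field_simp
  have hν0 : 0 < ν := by rw [hν]; positivity
  have e3 : 8 * ν * N * Λ * Λ * (Θbar + (n + 1)) = 8 / 50 * (Λ * R) := by
    have : N * (Θbar + (n + 1)) = R ^ 2 / 50 := by rw [hR2]; ring
    calc 8 * ν * N * Λ * Λ * (Θbar + (n + 1)) = 8 * ν * Λ * Λ * (N * (Θbar + (n + 1))) := by ring
      _ = _ := by rw [this, hν]; field_simp
  have h1 : u * L * (8 * ν * N * Λ * Θ + (n + 1) * (3 * ε / Λ))
      ≤ Λ * (8 * ν * N * Λ * Θbar + (n + 1) * (3 * ε / Λ)) := by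
    refine mul_le_mul huL ?_ (by positivity) hΛ0.le
    have : 8 * ν * N * Λ * Θ ≤ 8 * ν * N * Λ * Θbar :=
      mul_le_mul_of_nonneg_left hΘ (by positivity)
    linarith
  have h2 : 0 ≤ 8 * ν * N * Λ * Λ := by positivity
  have h3 : Λ * R * 1 ≤ Λ * R * N := mul_le_mul_of_nonneg_left hN (by positivity)
  have h4 : Λ * 7 ≤ Λ * R := mul_le_mul_of_nonneg_left hR7 hΛ0.le
  have h5 : 0 ≤ n * ε := by positivity
  rw [e1]
  have e4 : Λ * (n * (8 * ν * N * Λ + 3 * ε / Λ))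
      = 8 * ν * N * Λ * Λ * n + n * (Λ * (3 * ε / Λ)) := by ring
  have e5 : Λ * (8 * ν * N * Λ * Θbar + (n + 1) * (3 * ε / Λ))
      = 8 * ν * N * Λ * Λ * Θbar + (n + 1) * (Λ * (3 * ε / Λ)) := by ring
  rw [e4]
  rw [e5] at h1
  rw [e2] at h1 ⊢
  nlinarith

/-- **Corollary 3 (robustness): regret bound of FTPL against quantal-responding followers
with memory, where the perturbation rate `ν = 1/(‖U‖₁(1+L)√(50N(Θ̄+H)))` is tuned using only
an upper bound `Θ̄ ≥ Θ_H` (and `U ≠ 0`).**  Leader payoff matrix `U ≥ 0`; follower payoff matrices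
`V^1, …, V^K` with `L = 2η max_k ‖V^k‖₁`; nonnegative memory weights `a` with `a 0 > 0`;
follower types `g^1, …, g^H ∈ {e_1,…,e_K}` with partial sums `G^t`; `σ` has i.i.d.
exponential(ν) coordinates; the decision `x^t(σ) ∈ Δ_N` is an `ε`-approximate maximizer of
`x ↦ ⟨𝒴_QR(x)ᵀUᵀx, G^{t−1}⟩ + ⟨σ, x⟩` over `Δ_N` for every `σ ≥ 0` (0-indexed: round
`t < H` uses `G t = ∑_{τ<t} g τ`).  Then
`E[max_{x∈Δ_N} ⟨𝒴_QR(x)ᵀUᵀx, G^H⟩ − ∑_t ⟨𝒴_QR(z^t)ᵀUᵀx^t, g^t⟩]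
  ≤ 10N‖U‖₁(1+L)√(2N(H+Θ̄)) + ε(13H+1)`. -/
theorem stmt11 {N M K : ℕ} (hN : 0 < N) (hM : 0 < M) (hK : 0 < K)
    (H : ℕ) (hH : 0 < H)
    (ε ν η : ℝ) (hε : 0 ≤ ε) (hη : 0 < η)
    (U : Matrix (Fin N) (Fin M) ℝ) (hU : ∀ i j, 0 ≤ U i j) (hU0 : U ≠ 0)
    (V : Fin K → Matrix (Fin N) (Fin M) ℝ) (L : ℝ)
    (hL : L = 2 * η * Finset.univ.sup' (Finset.univ_nonempty_iff.mpr ⟨⟨0, hK⟩⟩)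
      (fun k => l1OpNorm (V k)))
    (a : ℕ → ℝ) (ha : ∀ s, 0 ≤ a s) (ha0 : 0 < a 0)
    (Θbar : ℝ) (hΘbar : memThetaSum a H ≤ Θbar)
    (hν : ν = (l1OpNorm U * (1 + L) * Real.sqrt (50 * N * (Θbar + H)))⁻¹)
    (g : ℕ → Fin K → ℝ) (hg : ∀ t < H, ∃ k, g t = Pi.single k 1)
    (x : ℕ → (Fin N → ℝ) → (Fin N → ℝ)) (hxmeas : ∀ t, Measurable (x t))
    (hxsimplex : ∀ t < H, ∀ σ : Fin N → ℝ, (∀ i, 0 ≤ σ i) → x t σ ∈ stdSimplex ℝ (Fin N))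
    (hOracle : ∀ σ : Fin N → ℝ, (∀ i, 0 ≤ σ i) → ∀ t < H,
      sSup ((fun y => qrPayoff η U V y y (∑ τ ∈ Finset.range t, g τ) + ∑ i, σ i * y i) ''
          stdSimplex ℝ (Fin N)) - ε ≤
        qrPayoff η U V (x t σ) (x t σ) (∑ τ ∈ Finset.range t, g τ) + ∑ i, σ i * x t σ i) :
    (∫ σ, (sSup ((fun y => qrPayoff η U V y y (∑ τ ∈ Finset.range H, g τ)) ''
          stdSimplex ℝ (Fin N))
        - ∑ t ∈ Finset.range H,
            qrPayoff η U V (reput a (fun τ => x τ σ) t) (x t σ) (g t))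
      ∂(expPi N ν)) ≤
      10 * N * l1OpNorm U * (1 + L) * Real.sqrt (2 * N * (H + Θbar))
        + ε * (13 * H + 1) := by
  have hNr : (1 : ℝ) ≤ N := by exact_mod_cast hN
  have hu := aux_norm_pos U hU0
  have hLk : ∀ k, 2 * η * l1OpNorm (V k) ≤ L := by
    intro k
    rw [hL]
    exact mul_le_mul_of_nonneg_left
      (Finset.le_sup' (fun k => l1OpNorm (V k)) (Finset.mem_univ k)) (by positivity)
  have hL0 : 0 ≤ L :=
    le_trans (mul_nonneg (by positivity) (aux_norm_nonneg (V ⟨0, hK⟩))) (hLk ⟨0, hK⟩)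
  set u := l1OpNorm U with hudef
  obtain ⟨Λ, hΛ⟩ : ∃ Λ, Λ = u * (1 + L) := ⟨_, rfl⟩
  have hΛ0 : 0 < Λ := by rw [hΛ]; positivity
  obtain ⟨n, rfl⟩ : ∃ n, H = n + 1 := ⟨H - 1, by omega⟩
  have hΘ0 : 0 ≤ memThetaSum a (n + 1) :=
    Finset.sum_nonneg fun t _ => aux_memTheta_nonneg a ha ha0 t
  obtain ⟨R, hR⟩ : ∃ R, R = Real.sqrt (50 * N * (Θbar + (n + 1))) := ⟨_, rfl⟩
  have hR0 : 0 < R := by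
    rw [hR]; apply Real.sqrt_pos.mpr
    have : 0 < Θbar + ((n : ℝ) + 1) := by
      have : (0 : ℝ) ≤ n := Nat.cast_nonneg n
      linarith
    positivity
  have hν' : ν = (Λ * R)⁻¹ := by rw [hν, hΛ, hR]; push_cast; rfl
  have hν0 : 0 < ν := by rw [hν']; positivity
  have hprob := aux_isProb (N := N) hν0
  have hfin := aux_final hNr hu hL0 hε hΘ0 hΘbar hΛ hR hν'
  have hRHS : 10 * N * u * (1 + L) * Real.sqrt (2 * N * ((n + 1 : ℕ) + Θbar))
      + ε * (13 * (n + 1 : ℕ) + 1) = 2 * N * Λ * R + ε * (13 * (n + 1) + 1) := by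
    have : R = 5 * Real.sqrt (2 * N * ((n + 1 : ℕ) + Θbar)) := by
      rw [hR, show 50 * N * (Θbar + (n + 1)) = 5 ^ 2 * (2 * N * (((n + 1 : ℕ) : ℝ) + Θbar)) by
        push_cast; ring, Real.sqrt_mul (by norm_num), Real.sqrt_sq (by norm_num)]
    rw [this, hΛ]
    push_cast
    ring
  rw [hRHS]
  refine le_trans ?_ hfin
  -- payoff of a single round
  obtain ⟨f, hf⟩ : ∃ f : ℕ → (Fin N → ℝ) → ℝ, ∀ t y, f t y = qrPayoff η U V y y (g t) :=
    ⟨fun t y => qrPayoff η U V y y (g t), fun _ _ => rfl⟩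
  have hF : ∀ t y, qrPayoff η U V y y (∑ τ ∈ Finset.range t, g τ)
      = ∑ τ ∈ Finset.range t, f τ y := by
    intro t y
    rw [aux_payoff_sum]
    exact Finset.sum_congr rfl fun τ _ => (hf τ y).symm
  have hpb : ∀ t < n + 1, ∀ z, ∀ y ∈ stdSimplex ℝ (Fin N),
      0 ≤ qrPayoff η U V z y (g t) ∧ qrPayoff η U V z y (g t) ≤ u := by
    intro t ht z y hy
    obtain ⟨k, hk⟩ := hg t ht
    rw [hk]
    exact aux_payoff_bounds hM η U hU V z y hy k
  have hflip : ∀ t < n + 1, ∀ y ∈ stdSimplex ℝ (Fin N), ∀ y' ∈ stdSimplex ℝ (Fin N),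
      |f t y - f t y'| ≤ Λ * ∑ i, |y i - y' i| := by
    intro t ht y _ y' hy'
    obtain ⟨k, hk⟩ := hg t ht
    rw [hf, hf, hk, hΛ]
    exact aux_payoff_lip hM hη U V y y' hy' k L (hLk k)
  have hzlip : ∀ t < n + 1, ∀ z, ∀ y ∈ stdSimplex ℝ (Fin N),
      f t y - qrPayoff η U V z y (g t) ≤ u * L * ∑ i, |y i - z i| := by
    intro t ht z y hy
    obtain ⟨k, hk⟩ := hg t ht
    rw [hf, hk]
    exact (le_abs_self _).trans (aux_payoff_lip_left hM hη U V y z y hy k L (hLk k))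
  have hσle : ∀ σ : Fin N → ℝ, (∀ i, 0 ≤ σ i) → ∀ y ∈ stdSimplex ℝ (Fin N),
      ∑ i, σ i * y i ≤ ∑ i, σ i := fun σ hσ y hy =>
    Finset.sum_le_sum fun i _ => mul_le_of_le_one_right (hσ i) (aux_simplex_le_one hy i)
  have hor : ∀ t < n + 1, ∀ σ : Fin N → ℝ, (∀ i, 0 ≤ σ i) → ∀ y ∈ stdSimplex ℝ (Fin N),
      ∑ τ ∈ Finset.range t, f τ y + ∑ i, σ i * y i - ε
        ≤ ∑ τ ∈ Finset.range t, f τ (x t σ) + ∑ i, σ i * x t σ i := by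
    intro t ht σ hσ y hy
    have h := hOracle σ hσ t ht
    rw [hF] at h
    refine le_trans (sub_le_sub_right ?_ ε) h
    have hb : BddAbove ((fun y => qrPayoff η U V y y (∑ τ ∈ Finset.range t, g τ)
        + ∑ i, σ i * y i) '' stdSimplex ℝ (Fin N)) := by
      refine ⟨∑ τ ∈ Finset.range t, u + ∑ i, σ i, ?_⟩
      rintro _ ⟨w, hw, rfl⟩
      simp only
      rw [hF]
      refine add_le_add (Finset.sum_le_sum fun τ hτ => ?_) (hσle σ hσ w hw)
      rw [hf]
      exact (hpb τ ((Finset.mem_range.mp hτ).trans ht) w w hw).2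
    refine le_csSup hb ⟨y, hy, ?_⟩
    simp only
    rw [hF]
  -- stability
  have hdi : ∀ τ < n + 1, ∀ t < n + 1,
      Integrable (fun σ => ∑ i, |x τ σ i - x t σ i|) (expPi N ν) := fun τ hτ t ht =>
    aux_integrable_dist hν0 _ _ (hxmeas τ) (hxmeas t) (hxsimplex τ hτ) (hxsimplex t ht)
  have hd : ∀ t < n + 1, ∀ τ ≤ t, ∫ σ, ∑ i, |x τ σ i - x t σ i| ∂(expPi N ν)
      ≤ 8 * ν * N * Λ * ((t - τ : ℕ) : ℝ) + 3 * ε / Λ := by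
    intro t ht τ hτ
    rcases hτ.eq_or_lt with rfl | hlt
    · simp only [sub_self, abs_zero, Finset.sum_const_zero, integral_zero]
      positivity
    have hm1 : (1 : ℝ) ≤ ((t - τ : ℕ) : ℝ) := by
      have : 1 ≤ t - τ := by omega
      exact_mod_cast this
    have h := aux_stab hN hν0 hε (l := ((t - τ : ℕ) : ℝ) * Λ) (by positivity)
      (fun y => ∑ s ∈ Finset.range τ, f s y) (fun y => ∑ s ∈ Finset.range t, f s y)
      (fun y hy y' hy' => by
        rw [← Finset.sum_Ico_eq_sub _ hτ, ← Finset.sum_Ico_eq_sub _ hτ,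
          ← Finset.sum_sub_distrib]
        refine (Finset.abs_sum_le_sum_abs _ _).trans ?_
        calc ∑ s ∈ Finset.Ico τ t, |f s y - f s y'|
            ≤ ∑ s ∈ Finset.Ico τ t, Λ * ∑ i, |y i - y' i| :=
              Finset.sum_le_sum fun s hs =>
                hflip s ((Finset.mem_Ico.mp hs).2.trans ht) y hy y' hy'
          _ = _ := by
              rw [Finset.sum_const, Nat.card_Ico, nsmul_eq_mul]; ring)
      (x τ) (x t) (hxmeas τ) (hxmeas t) (hxsimplex τ (hlt.trans ht)) (hxsimplex t ht)
      (hor τ (hlt.trans ht)) (hor t ht)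
    refine h.trans ?_
    have h1 : 3 * ε / (((t - τ : ℕ) : ℝ) * Λ) ≤ 3 * ε / Λ :=
      div_le_div_of_nonneg_left (by positivity) hΛ0 (le_mul_of_one_le_left hΛ0.le hm1)
    linarith
  -- be the leader
  have hbtl : ∀ σ : Fin N → ℝ, (∀ i, 0 ≤ σ i) → ∀ m < n + 1, ∀ y ∈ stdSimplex ℝ (Fin N),
      ∑ τ ∈ Finset.range m, f τ y + ∑ i, σ i * y i
        ≤ ∑ i, σ i + ∑ s ∈ Finset.range m, f s (x (s + 1) σ) + m * ε := by
    intro σ hσ m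
    induction m with
    | zero => intro _ y hy; simpa using hσle σ hσ y hy
    | succ m ih =>
      intro hm y hy
      have h1 := hor (m + 1) hm σ hσ y hy
      have h2 := ih (by omega) (x (m + 1) σ) (hxsimplex _ hm σ hσ)
      rw [Finset.sum_range_succ _ m, Finset.sum_range_succ _ m] at h1
      rw [Finset.sum_range_succ _ m, Finset.sum_range_succ _ m]
      push_cast
      linarith
  -- the pointwise regret bound
  have hpt : ∀ σ : Fin N → ℝ, (∀ i, 0 ≤ σ i) →
      sSup ((fun y => qrPayoff η U V y y (∑ τ ∈ Finset.range (n + 1), g τ)) ''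
          stdSimplex ℝ (Fin N))
        - ∑ t ∈ Finset.range (n + 1),
            qrPayoff η U V (reput a (fun τ => x τ σ) t) (x t σ) (g t)
      ≤ (∑ i, σ i) + (u + n * ε)
        + Λ * (∑ s ∈ Finset.range n, ∑ i, |x s σ i - x (s + 1) σ i|)
        + u * L * (∑ t ∈ Finset.range (n + 1), (memB a (t + 1))⁻¹ *
          ∑ τ ∈ Finset.range (t + 1), a (t - τ) * ∑ i, |x τ σ i - x t σ i|) := by
    intro σ hσ
    have hsup : sSup ((fun y => qrPayoff η U V y y (∑ τ ∈ Finset.range (n + 1), g τ)) ''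
          stdSimplex ℝ (Fin N))
        ≤ ∑ i, σ i + ∑ s ∈ Finset.range n, f s (x (s + 1) σ) + n * ε + u := by
      refine csSup_le (Set.Nonempty.image _ ⟨_, hxsimplex 0 hH σ hσ⟩) ?_
      rintro _ ⟨y, hy, rfl⟩
      simp only
      rw [hF, Finset.sum_range_succ]
      have h1 := hbtl σ hσ n (by omega) y hy
      have h2 := (hpb n (by omega) y y hy).2
      rw [← hf] at h2
      have h3 : 0 ≤ ∑ i, σ i * y i := Finset.sum_nonneg fun i _ => mul_nonneg (hσ i) (hy.1 i)
      linarith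
    have hA : ∑ s ∈ Finset.range n, f s (x (s + 1) σ)
        ≤ ∑ s ∈ Finset.range n, f s (x s σ)
          + Λ * (∑ s ∈ Finset.range n, ∑ i, |x s σ i - x (s + 1) σ i|) := by
      rw [Finset.mul_sum, ← Finset.sum_add_distrib]
      refine Finset.sum_le_sum fun s hs => ?_
      have hs' := Finset.mem_range.mp hs
      have h := (abs_le.mp (hflip s (by omega) _ (hxsimplex s (by omega) σ hσ) _
        (hxsimplex (s + 1) (by omega) σ hσ))).1
      linarith
    have hB : ∑ t ∈ Finset.range (n + 1), f t (x t σ)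
        ≤ ∑ t ∈ Finset.range (n + 1),
            qrPayoff η U V (reput a (fun τ => x τ σ) t) (x t σ) (g t)
          + u * L * (∑ t ∈ Finset.range (n + 1), (memB a (t + 1))⁻¹ *
          ∑ τ ∈ Finset.range (t + 1), a (t - τ) * ∑ i, |x τ σ i - x t σ i|) := by
      rw [Finset.mul_sum, ← Finset.sum_add_distrib]
      refine Finset.sum_le_sum fun t ht => ?_
      have ht' := Finset.mem_range.mp ht
      have h1 := hzlip t ht' (reput a (fun τ => x τ σ) t) (x t σ) (hxsimplex t ht' σ hσ)
      have h2 := mul_le_mul_of_nonneg_left (aux_reput a ha ha0 (fun τ => x τ σ) t)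
        (show 0 ≤ u * L by positivity)
      linarith
    rw [Finset.sum_range_succ (fun t => f t (x t σ))] at hB
    have hC : 0 ≤ f n (x n σ) := by
      rw [hf]; exact (hpb n (by omega) _ _ (hxsimplex n (by omega) σ hσ)).1
    linarith
  by_cases hint : Integrable (fun σ => sSup ((fun y => qrPayoff η U V y y
      (∑ τ ∈ Finset.range (n + 1), g τ)) '' stdSimplex ℝ (Fin N))
        - ∑ t ∈ Finset.range (n + 1),
            qrPayoff η U V (reput a (fun τ => x τ σ) t) (x t σ) (g t)) (expPi N ν)
  swap
  · rw [integral_undef hint]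
    have : 0 ≤ u * L := by positivity
    positivity
  have i1 : Integrable (fun σ : Fin N → ℝ => ∑ i, σ i) (expPi N ν) :=
    integrable_finsetSum _ fun i _ => (aux_mean hν0 i).1
  have i2 : ∀ s ∈ Finset.range n,
      Integrable (fun σ => ∑ i, |x s σ i - x (s + 1) σ i|) (expPi N ν) := fun s hs => by
    have := Finset.mem_range.mp hs
    exact hdi s (by omega) (s + 1) (by omega)
  have i3 : ∀ t ∈ Finset.range (n + 1), ∀ τ ∈ Finset.range (t + 1),
      Integrable (fun σ => a (t - τ) * ∑ i, |x τ σ i - x t σ i|) (expPi N ν) :=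
    fun t ht τ hτ => by
      have := Finset.mem_range.mp ht
      have := Finset.mem_range.mp hτ
      exact (hdi τ (by omega) t (by omega)).const_mul _
  have i4 : ∀ t ∈ Finset.range (n + 1),
      Integrable (fun σ => (memB a (t + 1))⁻¹ *
          ∑ τ ∈ Finset.range (t + 1), a (t - τ) * ∑ i, |x τ σ i - x t σ i|) (expPi N ν) :=
    fun t ht => (integrable_finsetSum _ (i3 t ht)).const_mul _
  have j1 : Integrable (fun σ : Fin N → ℝ => (∑ i, σ i) + (u + n * ε)) (expPi N ν) :=
    i1.add (integrable_const _)
  have j2 : Integrable (fun σ : Fin N → ℝ =>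
      Λ * (∑ s ∈ Finset.range n, ∑ i, |x s σ i - x (s + 1) σ i|)) (expPi N ν) :=
    (integrable_finsetSum _ i2).const_mul _
  have j12 : Integrable (fun σ : Fin N → ℝ => (∑ i, σ i) + (u + n * ε)
      + Λ * (∑ s ∈ Finset.range n, ∑ i, |x s σ i - x (s + 1) σ i|)) (expPi N ν) := j1.add j2
  have j3 : Integrable (fun σ : Fin N → ℝ => u * L * (∑ t ∈ Finset.range (n + 1),
      (memB a (t + 1))⁻¹ *
          ∑ τ ∈ Finset.range (t + 1), a (t - τ) * ∑ i, |x τ σ i - x t σ i|)) (expPi N ν) :=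
    (integrable_finsetSum _ i4).const_mul _
  refine (integral_mono_ae hint (j12.add j3) (by
    filter_upwards [aux_ae_nonneg hν0] with σ hσ using hpt σ hσ)).trans ?_
  simp only [Pi.add_apply]
  rw [integral_add j12 j3, integral_add j1 j2, integral_add i1 (integrable_const _),
    integral_const_mul, integral_const_mul, integral_finsetSum _ i2, integral_finsetSum _ i4,
    integral_finsetSum _ fun i _ => (aux_mean hν0 i).1]
  have k1 : ∑ i : Fin N, ∫ σ, σ i ∂(expPi N ν) = N * (1 / ν) := by
    rw [Finset.sum_congr rfl fun i _ => (aux_mean hν0 i).2]; simp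
  have k2 : ∑ s ∈ Finset.range n, ∫ σ, ∑ i, |x s σ i - x (s + 1) σ i| ∂(expPi N ν)
      ≤ n * (8 * ν * N * Λ + 3 * ε / Λ) := by
    calc _ ≤ ∑ s ∈ Finset.range n, (8 * ν * N * Λ + 3 * ε / Λ) := by
          refine Finset.sum_le_sum fun s hs => ?_
          have := Finset.mem_range.mp hs
          simpa using hd (s + 1) (by omega) s (by omega)
      _ = _ := by rw [Finset.sum_const, Finset.card_range, nsmul_eq_mul]
  have k3 : ∑ t ∈ Finset.range (n + 1), ∫ σ, (memB a (t + 1))⁻¹ *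
          ∑ τ ∈ Finset.range (t + 1), a (t - τ) * ∑ i, |x τ σ i - x t σ i| ∂(expPi N ν)
      ≤ 8 * ν * N * Λ * memThetaSum a (n + 1) + (n + 1) * (3 * ε / Λ) := by
    calc _ ≤ ∑ t ∈ Finset.range (n + 1), (8 * ν * N * Λ * memTheta a (t + 1) + 3 * ε / Λ) := by
          refine Finset.sum_le_sum fun t ht => ?_
          have ht' := Finset.mem_range.mp ht
          have hb := aux_memB_pos a ha ha0 t
          rw [integral_const_mul, integral_finsetSum _ (i3 t ht)]
          have e1 := aux_reflect a (fun s => 8 * ν * N * Λ * (s : ℝ) + 3 * ε / Λ) t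
          have e2 : ∑ s ∈ Finset.range (t + 1), a s * (8 * ν * N * Λ * (s : ℝ) + 3 * ε / Λ)
              = 8 * ν * N * Λ * (∑ s ∈ Finset.range (t + 1), a s * s)
                + memB a (t + 1) * (3 * ε / Λ) := by
            unfold memB
            rw [Finset.mul_sum, Finset.sum_mul, ← Finset.sum_add_distrib]
            exact Finset.sum_congr rfl fun s _ => by ring
          calc (memB a (t + 1))⁻¹ * ∑ τ ∈ Finset.range (t + 1),
                ∫ σ, a (t - τ) * ∑ i, |x τ σ i - x t σ i| ∂(expPi N ν)
              ≤ (memB a (t + 1))⁻¹ * ∑ τ ∈ Finset.range (t + 1),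
                a (t - τ) * (8 * ν * N * Λ * ((t - τ : ℕ) : ℝ) + 3 * ε / Λ) := by
                refine mul_le_mul_of_nonneg_left ?_ (inv_pos.mpr hb).le
                refine Finset.sum_le_sum fun τ hτ => ?_
                have := Finset.mem_range.mp hτ
                rw [integral_const_mul]
                exact mul_le_mul_of_nonneg_left (hd t ht' τ (by omega)) (ha _)
            _ = (memB a (t + 1))⁻¹ * (8 * ν * N * Λ * (∑ s ∈ Finset.range (t + 1), a s * s)
                + memB a (t + 1) * (3 * ε / Λ)) := by rw [e1, e2]
            _ = _ := by
                unfold memTheta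
                rw [mul_add, ← mul_assoc _ (memB a (t + 1)), inv_mul_cancel₀ hb.ne']
                ring
      _ = _ := by
          unfold memThetaSum
          rw [Finset.sum_add_distrib, ← Finset.mul_sum]
          simp
  rw [k1]
  simp only [integral_const, probReal_univ, one_smul]
  have k2' := mul_le_mul_of_nonneg_left k2 hΛ0.le
  have k3' := mul_le_mul_of_nonneg_left k3 (show 0 ≤ u * L by positivity)
  linarith
end

section
/- Let X ⊆ ℝ^N be a nonempty convex set whose ℓ∞-diameter is at most D (i.e., ‖u − v‖_∞ ≤ D for all u, v ∈ X), let L > 0, ν > 0, ε ≥ 0, and let f^1, f^2, … be functions X → ℝ each of which is L-Lipschitz with respect to the ℓ₁-norm (|f^τ(u) − f^τ(v)| ≤ L‖u − v‖₁ for all u, v ∈ X). Let σ = (σ_1,…,σ_N) have i.i.d. coordinates exponentially distributed with rate ν, and suppose x_1, x_2, … are measurable X-valued functions on ℝ^N_{≥0} such that for every σ ∈ ℝ^N_{≥0} and every index t ≥ 1, x_t(σ) is an ε-approximate minimizer over X of the map x ↦ Σ_{τ=1}^{t−1} f^τ(x) − ⟨σ, x⟩ (the sum being empty for t = 1). Then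 for all integers t ≥ 1 and h ≥ 1, E[‖x_{t+h}(σ) − x_t(σ)‖₁] ≤ 50 ν h L N² D + 6ε/(hL), where the expectation is over σ. -/
open MeasureTheory

open ProbabilityTheory

lemma aux_exp_shift (ν c : ℝ) (hν : 0 < ν) (hc : 0 ≤ c) (φ : ℝ → ENNReal) (hφ : Measurable φ) :
    ∫⁻ s, φ (s + c) ∂(expMeasure ν) ≤
      ∫⁻ s, ENNReal.ofReal (Real.exp (ν * c)) * φ s ∂(expMeasure ν) := by
  have hE : expMeasure ν = volume.withDensity (exponentialPDF ν) := rfl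
  have hm : Measurable (exponentialPDF ν) := (measurable_exponentialPDFReal ν).ennreal_ofReal
  rw [hE, lintegral_withDensity_eq_lintegral_mul _ hm (by fun_prop),
    lintegral_withDensity_eq_lintegral_mul _ hm (by fun_prop)]
  rw [← lintegral_add_right_eq_self (exponentialPDF ν * fun s =>
    ENNReal.ofReal (Real.exp (ν * c)) * φ s) c]
  apply lintegral_mono
  intro s
  simp only [Pi.mul_apply]
  rw [← mul_assoc]
  gcongr
  rcases lt_or_ge s 0 with hs | hs
  · rw [exponentialPDF_of_neg hs]; exact bot_le
  · rw [exponentialPDF_of_nonneg hs, exponentialPDF_of_nonneg (by linarith),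
      ← ENNReal.ofReal_mul (by positivity)]
    apply ENNReal.ofReal_le_ofReal
    rw [mul_assoc, ← Real.exp_add]
    apply le_of_eq
    congr 2
    ring

lemma aux_pi_shift {N : ℕ} (ν c : ℝ) (hν : 0 < ν) (hc : 0 ≤ c) (i : Fin N)
    (ψ : (Fin N → ℝ) → ENNReal) (hψ : Measurable ψ) :
    ∫⁻ σ, ψ (Function.update σ i (σ i + c)) ∂(expPi N ν) ≤
      ∫⁻ σ, ENNReal.ofReal (Real.exp (ν * c)) * ψ σ ∂(expPi N ν) := by
  have := isProbabilityMeasure_expMeasure hν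
  unfold expPi
  have hup : Measurable (fun σ : Fin N → ℝ => Function.update σ i (σ i + c)) := by
    rw [measurable_pi_iff]
    intro j
    by_cases h : j = i
    · subst h; simp; fun_prop
    · simp [Function.update_of_ne h]; fun_prop
  apply lintegral_le_of_lmarginal_le {i} (hψ.comp hup) (by fun_prop)
  rw [lmarginal_singleton, lmarginal_singleton]
  intro y
  simp only [Function.comp_def, Function.update_self, Function.update_idem]
  exact aux_exp_shift ν c hν hc (fun s => ψ (Function.update y i s))
    (hψ.comp (measurable_update y))

lemma aux_nonneg {N : ℕ} (ν : ℝ) (hν : 0 < ν) : ∀ᵐ σ ∂(expPi N ν), ∀ i, 0 ≤ σ i := by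
  have := isProbabilityMeasure_expMeasure hν
  rw [ae_all_iff]
  intro i
  have h1 : ∀ᵐ s ∂(expMeasure ν), 0 ≤ s := by
    have hE : expMeasure ν = volume.withDensity (exponentialPDF ν) := rfl
    have hm : Measurable (exponentialPDF ν) := (measurable_exponentialPDFReal ν).ennreal_ofReal
    rw [hE, ae_withDensity_iff hm]
    refine Filter.Eventually.of_forall fun s hs => ?_
    by_contra h
    exact hs (exponentialPDF_of_neg (not_le.1 h))
  exact (Measure.tendsto_eval_ae_ae (μ := fun _ : Fin N => expMeasure ν) (i := i)).eventually h1

lemma aux_upd_nonneg {N : ℕ} (c : ℝ) (hc : 0 ≤ c) (i : Fin N) (σ : Fin N → ℝ)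
    (h : ∀ j, 0 ≤ σ j) : ∀ j, 0 ≤ Function.update σ i (σ i + c) j := by
  intro j
  by_cases hj : j = i
  · subst hj; simp; linarith [h j]
  · simpa [Function.update_of_ne hj] using h j

lemma aux_meas_upd {N : ℕ} (c : ℝ) (i : Fin N) :
    Measurable (fun σ : Fin N → ℝ => Function.update σ i (σ i + c)) := by
  rw [measurable_pi_iff]
  intro j
  by_cases h : j = i
  · subst h; simp; fun_prop
  · simp [Function.update_of_ne h]; fun_prop

lemma aux_int {N : ℕ} (ν : ℝ) (hν : 0 < ν) (K : ℝ)
    (ψ : (Fin N → ℝ) → ℝ) (hψ : Measurable ψ)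
    (hb : ∀ σ : Fin N → ℝ, (∀ j, 0 ≤ σ j) → |ψ σ| ≤ K) : Integrable ψ (expPi N ν) := by
  have := isProbabilityMeasure_expMeasure hν
  have : IsProbabilityMeasure (expPi N ν) := by unfold expPi; infer_instance
  refine Integrable.of_bound hψ.aestronglyMeasurable K ?_
  filter_upwards [aux_nonneg ν hν] with σ hσ using hb σ hσ

lemma aux_real_shift {N : ℕ} (ν c K : ℝ) (hν : 0 < ν) (hc : 0 ≤ c) (i : Fin N)
    (ψ : (Fin N → ℝ) → ℝ) (hψ : Measurable ψ)
    (h0 : ∀ σ : Fin N → ℝ, (∀ j, 0 ≤ σ j) → 0 ≤ ψ σ)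
    (hK : ∀ σ : Fin N → ℝ, (∀ j, 0 ≤ σ j) → ψ σ ≤ K) :
    ∫ σ, ψ (Function.update σ i (σ i + c)) ∂(expPi N ν) ≤ ∫ σ, ψ σ ∂(expPi N ν) + ν * c * K := by
  have := isProbabilityMeasure_expMeasure hν
  have : IsProbabilityMeasure (expPi N ν) := by unfold expPi; infer_instance
  have hi := aux_int ν hν K ψ hψ (fun σ hσ => by rw [abs_of_nonneg (h0 σ hσ)]; exact hK σ hσ)
  have hi' := aux_int ν hν K _ (hψ.comp (aux_meas_upd c i)) (fun σ hσ => by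
    have := aux_upd_nonneg c hc i σ hσ
    simp only [Function.comp]
    rw [abs_of_nonneg (h0 _ this)]; exact hK _ this)
  simp only [Function.comp_def] at hi'
  have key := aux_pi_shift ν c hν hc i (fun σ => ENNReal.ofReal (ψ σ)) hψ.ennreal_ofReal
  have hn : 0 ≤ᵐ[expPi N ν] ψ := by
    filter_upwards [aux_nonneg ν hν] with σ hσ using h0 σ hσ
  have hn' : 0 ≤ᵐ[expPi N ν] fun σ => ψ (Function.update σ i (σ i + c)) := by
    filter_upwards [aux_nonneg ν hν] with σ hσ using h0 _ (aux_upd_nonneg c hc i σ hσ)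
  rw [lintegral_const_mul _ hψ.ennreal_ofReal, ← ofReal_integral_eq_lintegral_ofReal hi hn,
    ← ofReal_integral_eq_lintegral_ofReal hi' hn', ← ENNReal.ofReal_mul (by positivity),
    ENNReal.ofReal_le_ofReal_iff (mul_nonneg (by positivity) (integral_nonneg_of_ae hn))] at key
  set A := ∫ σ, ψ (Function.update σ i (σ i + c)) ∂(expPi N ν)
  set B := ∫ σ, ψ σ ∂(expPi N ν)
  have hA0 : 0 ≤ A := integral_nonneg_of_ae hn'
  have hAK : A ≤ K := by
    have : A ≤ ∫ _, K ∂(expPi N ν) := integral_mono_ae hi' (integrable_const _) (by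
      filter_upwards [aux_nonneg ν hν] with σ hσ using hK _ (aux_upd_nonneg c hc i σ hσ))
    simpa using this
  have h1 : Real.exp (-(ν * c)) * A ≤ B := by
    rw [Real.exp_neg, inv_mul_le_iff₀ (Real.exp_pos _)]; exact key
  have h2 : 1 - ν * c ≤ Real.exp (-(ν * c)) := by
    linarith [Real.add_one_le_exp (-(ν * c))]
  have h3 : (0:ℝ) ≤ ν * c := by positivity
  nlinarith [mul_le_mul_of_nonneg_right h2 hA0, mul_le_mul_of_nonneg_left hAK h3]

lemma aux_oracle {N : ℕ} (X : Set (Fin N → ℝ)) 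
    (D : ℝ) (hD : ∀ u ∈ X, ∀ v ∈ X, ‖u - v‖ ≤ D)
    (L ε : ℝ) (hL : 0 < L)
    (f : ℕ → (Fin N → ℝ) → ℝ)
    (hf : ∀ τ : ℕ, ∀ u ∈ X, ∀ v ∈ X, |f τ u - f τ v| ≤ L * ∑ i, |u i - v i|)
    (σ : Fin N → ℝ) (hσ : ∀ i, 0 ≤ σ i) (t : ℕ) (r : ℝ)
    (h : r ≤ sInf ((fun y => (∑ τ ∈ Finset.range t, f τ y) - ∑ i, σ i * y i) '' X) + ε)
    (y : Fin N → ℝ) (hy : y ∈ X) :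
    r ≤ (∑ τ ∈ Finset.range t, f τ y) - ∑ i, σ i * y i + ε := by
  refine h.trans ?_
  gcongr
  refine csInf_le ?_ ⟨y, hy, rfl⟩
  have hc : ∀ z ∈ X, ∀ i, |z i - y i| ≤ D := fun z hz i => by
    have := norm_le_pi_norm (z - y) i
    exact this.trans (hD z hz y hy)
  refine ⟨(∑ τ ∈ Finset.range t, (f τ y - L * ∑ i : Fin N, D)) - ∑ i, σ i * (y i + D), ?_⟩
  rintro _ ⟨z, hz, rfl⟩
  apply sub_le_sub
  · refine Finset.sum_le_sum fun τ _ => ?_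
    have h1 := (abs_le.1 (hf τ z hz y hy)).1
    have h2 : ∑ i, |z i - y i| ≤ ∑ i : Fin N, D := Finset.sum_le_sum fun i _ => hc z hz i
    have h3 := mul_le_mul_of_nonneg_left h2 hL.le
    linarith
  · refine Finset.sum_le_sum fun i _ => ?_
    exact mul_le_mul_of_nonneg_left (by linarith [(abs_le.1 (hc z hz i)).2]) (hσ i)

lemma aux_upd_sum {N : ℕ} (σ z : Fin N → ℝ) (c : ℝ) (i : Fin N) :
    ∑ j, Function.update σ i (σ i + c) j * z j = ∑ j, σ j * z j + c * z i := by
  have : ∀ j, Function.update σ i (σ i + c) j * z j = σ j * z j + if j = i then c * z i else 0 := by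
    intro j
    by_cases h : j = i
    · subst h; simp; ring
    · simp [h]
  simp [this, Finset.sum_add_distrib]

/-- **Lemma 2: stability of FTPL with exponential perturbations and an ε-approximate
oracle.**  `X ⊆ ℝ^N` nonempty convex with ℓ∞-diameter at most `D` (the norm on
`Fin N → ℝ` is the sup norm); each loss `f τ` is `L`-Lipschitz w.r.t. the ℓ₁-norm on `X`;
`σ` has i.i.d. exponential(ν) coordinates; for every `σ ≥ 0` and every `t`, `x t σ ∈ X` is
an `ε`-approximate minimizer over `X` of `y ↦ ∑_{τ<t} f τ y − ⟨σ, y⟩` (0-indexed, so the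
sum is empty for the first round `t = 0`).  Then for all `t` and all `h ≥ 1`,
`E[‖x (t+h) σ − x t σ‖₁] ≤ 50νhLN²D + 6ε/(hL)`. -/
theorem stmt14 {N : ℕ} (X : Set (Fin N → ℝ)) (hX : X.Nonempty) (hXconv : Convex ℝ X)
    (D : ℝ) (hD : ∀ u ∈ X, ∀ v ∈ X, ‖u - v‖ ≤ D)
    (L ν ε : ℝ) (hL : 0 < L) (hν : 0 < ν) (hε : 0 ≤ ε)
    (f : ℕ → (Fin N → ℝ) → ℝ)
    (hf : ∀ τ : ℕ, ∀ u ∈ X, ∀ v ∈ X, |f τ u - f τ v| ≤ L * ∑ i, |u i - v i|)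
    (x : ℕ → (Fin N → ℝ) → (Fin N → ℝ)) (hxmeas : ∀ t, Measurable (x t))
    (hxX : ∀ t : ℕ, ∀ σ : Fin N → ℝ, (∀ i, 0 ≤ σ i) → x t σ ∈ X)
    (hOracle : ∀ σ : Fin N → ℝ, (∀ i, 0 ≤ σ i) → ∀ t : ℕ,
      (∑ τ ∈ Finset.range t, f τ (x t σ)) - ∑ i, σ i * x t σ i ≤
        sInf ((fun y => (∑ τ ∈ Finset.range t, f τ y) - ∑ i, σ i * y i) '' X) + ε) :
    ∀ (t h : ℕ), 1 ≤ h →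
      (∫ σ, (∑ i, |x (t + h) σ i - x t σ i|) ∂(expPi N ν)) ≤
        50 * ν * h * L * N ^ 2 * D + 6 * ε / (h * L) := by
  intro t h hh
  have hD0 : 0 ≤ D := by
    obtain ⟨u, hu⟩ := hX
    exact (norm_nonneg _).trans (hD u hu u hu)
  have hh0 : (0:ℝ) < h := by exact_mod_cast hh
  rcases Nat.eq_zero_or_pos N with hN | hN
  · subst hN
    simp
    positivity
  have hN0 : (0:ℝ) < N := by exact_mod_cast hN
  set M : ℝ := h * L with hM
  have hM0 : 0 < M := by positivity
  set c : ℝ := 2 * N * M with hc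
  have hc0 : 0 < c := by positivity
  have hO : ∀ σ : Fin N → ℝ, (∀ i, 0 ≤ σ i) → ∀ s : ℕ, ∀ y ∈ X,
      (∑ τ ∈ Finset.range s, f τ (x s σ)) - ∑ i, σ i * x s σ i ≤
        (∑ τ ∈ Finset.range s, f τ y) - ∑ i, σ i * y i + ε := fun σ hσ s y hy =>
    aux_oracle X D hD L ε hL f hf σ hσ s _ (hOracle σ hσ s) y hy
  set g : (Fin N → ℝ) → ℝ := fun y => ∑ τ ∈ Finset.range h, f (t + τ) y with hg
  have hG : ∀ y, ∑ τ ∈ Finset.range (t + h), f τ y = ∑ τ ∈ Finset.range t, f τ y + g y :=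
    fun y => Finset.sum_range_add _ _ _
  have hgL : ∀ u ∈ X, ∀ v ∈ X, g u - g v ≤ M * ∑ i, |u i - v i| := by
    intro u hu v hv
    simp only [hg]
    rw [← Finset.sum_sub_distrib]
    calc _ ≤ ∑ τ ∈ Finset.range h, L * ∑ i, |u i - v i| :=
          Finset.sum_le_sum fun τ _ => (le_abs_self _).trans (hf _ u hu v hv)
      _ = _ := by simp [hM]; ring
  set S : (Fin N → ℝ) → ℝ := fun σ => ∑ i, |x (t + h) σ i - x t σ i| with hS
  set m : Fin N → (Fin N → ℝ) → ℝ := fun i σ => min (x (t + h) σ i) (x t σ i) with hm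
  have hpt : ∀ σ : Fin N → ℝ, (∀ i, 0 ≤ σ i) → ∀ i,
      |x (t + h) σ i - x t σ i| ≤ m i (Function.update σ i (σ i + c)) - m i σ
        + M / c * S σ + 3 * ε / c := by
    intro σ hσ i
    have hσ' := aux_upd_nonneg c hc0.le i σ hσ
    set σ' := Function.update σ i (σ i + c) with hσ'd
    have ha := hxX t σ hσ
    have hb := hxX (t + h) σ hσ
    have ha' := hxX t σ' hσ'
    have hb' := hxX (t + h) σ' hσ'
    have e1 := hO σ hσ t _ hb
    have e2 := hO σ hσ t _ ha'
    have e3 := hO σ hσ (t + h) _ ha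
    have e4 := hO σ hσ (t + h) _ hb'
    have e5 := hO σ' hσ' t _ ha
    have e6 := hO σ' hσ' t _ hb
    have e7 := hO σ' hσ' (t + h) _ ha
    have e8 := hO σ' hσ' (t + h) _ hb
    simp only [hG] at e3 e4 e7 e8
    rw [hσ'd, aux_upd_sum, aux_upd_sum, ← hσ'd] at e5 e6 e7 e8
    have hl := hgL _ ha _ hb
    have hSs : ∑ i, |x t σ i - x (t + h) σ i| = S σ := by
      simp only [hS]; exact Finset.sum_congr rfl fun j _ => abs_sub_comm _ _
    rw [hSs] at hl
    have hS0 : 0 ≤ S σ := Finset.sum_nonneg fun j _ => abs_nonneg _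
    have hMS : 0 ≤ M * S σ := by positivity
    set R := M / c * S σ + 3 * ε / c with hR
    have hcR : c * R = M * S σ + 3 * ε := by rw [hR]; field_simp
    have k1 : x t σ i - R ≤ x t σ' i := by
      refine le_of_mul_le_mul_left ?_ hc0
      rw [mul_sub, hcR]; linarith
    have k2 : x (t + h) σ i - R ≤ x t σ' i := by
      refine le_of_mul_le_mul_left ?_ hc0
      rw [mul_sub, hcR]; linarith
    have k3 : x t σ i - R ≤ x (t + h) σ' i := by
      refine le_of_mul_le_mul_left ?_ hc0
      rw [mul_sub, hcR]; linarith
    have k4 : x (t + h) σ i - R ≤ x (t + h) σ' i := by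
      refine le_of_mul_le_mul_left ?_ hc0
      rw [mul_sub, hcR]; linarith
    have k5 : max (x (t + h) σ i) (x t σ i) - R ≤ m i σ' := by
      simp only [hm]
      refine le_min ?_ ?_
      · rcases max_choice (x (t + h) σ i) (x t σ i) with q | q <;> rw [q] <;> assumption
      · rcases max_choice (x (t + h) σ i) (x t σ i) with q | q <;> rw [q] <;> assumption
    have k6 : |x (t + h) σ i - x t σ i| = max (x (t + h) σ i) (x t σ i) - m i σ := by
      simp only [hm]; exact (max_sub_min_eq_abs' _ _).symm
    rw [k6]; linarith
  obtain ⟨x0, hx0⟩ := hX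
  have hbd : ∀ s, ∀ σ : Fin N → ℝ, (∀ i, 0 ≤ σ i) → ∀ i, |x s σ i - x0 i| ≤ D := by
    intro s σ hσ i
    exact (norm_le_pi_norm (x s σ - x0) i).trans (hD _ (hxX s σ hσ) _ hx0)
  have hxm : ∀ s i, Measurable fun σ => x s σ i := fun s i => measurable_pi_iff.1 (hxmeas s) i
  have hmm : ∀ i, Measurable (m i) := fun i => (hxm _ i).min (hxm _ i)
  have hmb : ∀ i, ∀ σ : Fin N → ℝ, (∀ j, 0 ≤ σ j) → |m i σ - x0 i| ≤ D := by
    intro i σ hσ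
    simp only [hm]
    rcases min_choice (x (t + h) σ i) (x t σ i) with q | q <;> rw [q] <;> exact hbd _ σ hσ i
  have hP1 := isProbabilityMeasure_expMeasure hν
  have hP : IsProbabilityMeasure (expPi N ν) := by unfold expPi; infer_instance
  have hmi : ∀ i, Integrable (m i) (expPi N ν) := fun i =>
    aux_int ν hν (D + |x0 i|) _ (hmm i) fun σ hσ => by
      have := abs_add_le (m i σ - x0 i) (x0 i)
      rw [sub_add_cancel] at this
      linarith [hmb i σ hσ]
  have hmi' : ∀ i, Integrable (fun σ => m i (Function.update σ i (σ i + c))) (expPi N ν) := fun i =>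
    aux_int ν hν (D + |x0 i|) _ ((hmm i).comp (aux_meas_upd c i)) fun σ hσ => by
      set σ' := Function.update σ i (σ i + c)
      have := abs_add_le (m i σ' - x0 i) (x0 i)
      rw [sub_add_cancel] at this
      have h2 := hmb i σ' (aux_upd_nonneg c hc0.le i σ hσ)
      linarith
  have hdi : ∀ i, Integrable (fun σ => |x (t + h) σ i - x t σ i|) (expPi N ν) := fun i =>
    aux_int ν hν (2 * D) _ (((hxm _ i).sub (hxm _ i)).abs) fun σ hσ => by
      rw [abs_abs]
      have h1 := abs_le.1 (hbd t σ hσ i)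
      have h2 := abs_le.1 (hbd (t + h) σ hσ i)
      rw [abs_le]; constructor <;> linarith
  have hSi : Integrable S (expPi N ν) := integrable_finsetSum _ fun i _ => hdi i
  set T := ∫ σ, S σ ∂(expPi N ν) with hT
  have hsum : T = ∑ i, ∫ σ, |x (t + h) σ i - x t σ i| ∂(expPi N ν) :=
    integral_finsetSum _ fun i _ => hdi i
  have hcoord : ∀ i, ∫ σ, |x (t + h) σ i - x t σ i| ∂(expPi N ν) ≤
      ν * c * (2 * D) + M / c * T + 3 * ε / c := by
    intro i
    have hsh := aux_real_shift ν c (2 * D) hν hc0.le i (fun σ => m i σ - (x0 i - D))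
      ((hmm i).sub_const _)
      (fun σ hσ => by linarith [(abs_le.1 (hmb i σ hσ)).1])
      (fun σ hσ => by linarith [(abs_le.1 (hmb i σ hσ)).2])
    rw [integral_sub (hmi' i) (integrable_const _), integral_sub (hmi i) (integrable_const _)] at hsh
    have hle := integral_mono_ae (hdi i)
      ((((hmi' i).sub (hmi i)).add (hSi.const_mul (M / c))).add (integrable_const (3 * ε / c)))
      (by filter_upwards [aux_nonneg ν hν] with σ hσ using hpt σ hσ i)
    rw [integral_add' (((hmi' i).sub (hmi i)).add (hSi.const_mul (M / c)))
      (integrable_const (3 * ε / c)), integral_add' ((hmi' i).sub (hmi i)) (hSi.const_mul (M / c)),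
      integral_sub' (hmi' i) (hmi i), integral_const_mul, integral_const] at hle
    simp at hle
    linarith
  have hfin : T ≤ N * (ν * c * (2 * D) + M / c * T + 3 * ε / c) := by
    rw [hsum]
    refine (Finset.sum_le_sum fun i _ => hcoord i).trans ?_
    rw [← hsum]; simp
    apply le_of_eq; ring
  have e1 : N * (ν * c * (2 * D) + M / c * T + 3 * ε / c) =
      4 * (ν * M * N ^ 2 * D) + T / 2 + (3 / 2) * (ε / M) := by
    rw [hc]; field_simp; ring
  have p1 : 0 ≤ ν * M * N ^ 2 * D := by positivity
  have p2 : 0 ≤ ε / M := by positivity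
  have e2 : 50 * ν * h * L * N ^ 2 * D + 6 * ε / M = 50 * (ν * M * N ^ 2 * D) + 6 * (ε / M) := by
    rw [hM]; ring
  rw [e2]
  linarith
end

section
/- Let X ⊆ ℝ^N be a nonempty set, F : X → ℝ a function, ε ≥ 0, σ ∈ ℝ^N, c > 0, and i ∈ {1,…,N}; let e_i denote the i-th standard basis vector of ℝ^N. Suppose x ∈ X is an ε-approximate minimizer over X of the map u ↦ F(u) − ⟨σ, u⟩, and x' ∈ X is an ε-approximate minimizer over X of the map u ↦ F(u) − ⟨σ + c e_i, u⟩, where both infima are finite. Then the i-th coordinates satisfy x'_i ≥ x_i − 2ε/c. -/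
/-- **Lemma 3 (monotonicity of ε-approximate perturbed minimizers).**
`X ⊆ ℝ^N` nonempty, `F : X → ℝ`, `ε ≥ 0`, `σ ∈ ℝ^N`, `c > 0`, `i ∈ {1,…,N}`.
If `x ∈ X` is an `ε`-approximate minimizer over `X` of `u ↦ F(u) − ⟨σ, u⟩` and `x' ∈ X`
is an `ε`-approximate minimizer over `X` of `u ↦ F(u) − ⟨σ + c e_i, u⟩` (both infima being
finite, i.e. `BddBelow`), then `x'_i ≥ x_i − 2ε/c`. -/
theorem stmt15 {N : ℕ} (X : Set (Fin N → ℝ)) (hX : X.Nonempty)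
    (F : (Fin N → ℝ) → ℝ) (ε : ℝ) (hε : 0 ≤ ε) (σ : Fin N → ℝ) (c : ℝ) (hc : 0 < c)
    (i : Fin N) (x x' : Fin N → ℝ) (hxX : x ∈ X) (hx'X : x' ∈ X)
    (hBdd : BddBelow ((fun u => F u - ∑ n, σ n * u n) '' X))
    (hBdd' : BddBelow
      ((fun u => F u - ∑ n, (σ + c • (Pi.single i 1 : Fin N → ℝ)) n * u n) '' X))
    (hx : F x - ∑ n, σ n * x n ≤ sInf ((fun u => F u - ∑ n, σ n * u n) '' X) + ε)
    (hx' : F x' - ∑ n, (σ + c • (Pi.single i 1 : Fin N → ℝ)) n * x' n ≤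
      sInf ((fun u => F u - ∑ n, (σ + c • (Pi.single i 1 : Fin N → ℝ)) n * u n) '' X) + ε) :
    x i - 2 * ε / c ≤ x' i := by
  have key : ∀ u : Fin N → ℝ,
      ∑ n, (σ + c • (Pi.single i 1 : Fin N → ℝ)) n * u n = ∑ n, σ n * u n + c * u i := by
    intro u
    simp [add_mul, Finset.sum_add_distrib, Pi.single_apply]
  have h1 := csInf_le hBdd (Set.mem_image_of_mem _ hx'X)
  have h2 := csInf_le hBdd' (Set.mem_image_of_mem _ hxX)
  have h3 := hx'.trans (add_le_add_left h2 ε)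
  have h4 := hx.trans (add_le_add_left h1 ε)
  simp only [key] at h3 h4
  have h5 : (x i - x' i) * c ≤ 2 * ε := by linarith
  have h6 := (le_div_iff₀ hc).mpr h5
  linarith
end

section
/- Let X ⊆ ℝ^N be a nonempty set, L > 0, h ≥ 1 an integer, ε ≥ 0, p > 0, q > 0, i ∈ {1,…,N}, σ ∈ ℝ^N, and set σ' = σ + qLN e_i where e_i is the i-th standard basis vector. Let F : X → ℝ, let φ : X → ℝ be hL-Lipschitz with respect to the ℓ₁-norm, and set G = F + φ. Suppose x ∈ X is an ε-approximate minimizer over X of u ↦ F(u) − ⟨σ, u⟩, y ∈ X is an ε-approximate minimizer of u ↦ G(u) − ⟨σ, u⟩, x' ∈ X is an ε-approximate minimizer of u ↦ F(u) − ⟨σ', u⟩, and y' ∈ X is an ε-approximate minimizer of u ↦ G(u) − ⟨σ', u⟩, with all four infima finite. If ‖x − y‖₁ ≤ pN |x_i − y_i|, then min{x'_i, y'_i} ≥ max{x_i, y_i} − (ph/q)|x_i − y_i| − 3ε/(qLN). -/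
/-- **Lemma 4 (heterogeneous monotonicity of ε-approximate perturbed minimizers).**
`X ⊆ ℝ^N` nonempty, `L > 0`, `h ≥ 1` an integer, `ε ≥ 0`, `p, q > 0`, `i ∈ {1,…,N}`,
`σ' = σ + qLN e_i`.  `φ` is `hL`-Lipschitz w.r.t. the ℓ₁-norm on `X` and `G = F + φ`.
If `x, y, x', y' ∈ X` are `ε`-approximate minimizers over `X` of `u ↦ F(u) − ⟨σ, u⟩`,
`u ↦ G(u) − ⟨σ, u⟩`, `u ↦ F(u) − ⟨σ', u⟩` and `u ↦ G(u) − ⟨σ', u⟩` respectively (all four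
infima being finite, i.e. `BddBelow`), and if `‖x − y‖₁ ≤ pN|x_i − y_i|`, then
`min{x'_i, y'_i} ≥ max{x_i, y_i} − (ph/q)|x_i − y_i| − 3ε/(qLN)`. -/
theorem stmt16 {N : ℕ} (X : Set (Fin N → ℝ)) (hX : X.Nonempty)
    (L : ℝ) (hL : 0 < L) (h : ℕ) (hh : 1 ≤ h)
    (ε p q : ℝ) (hε : 0 ≤ ε) (hp : 0 < p) (hq : 0 < q)
    (i : Fin N) (σ : Fin N → ℝ)
    (F φ : (Fin N → ℝ) → ℝ)
    (hφ : ∀ u ∈ X, ∀ v ∈ X, |φ u - φ v| ≤ (h * L) * ∑ n, |u n - v n|)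
    (x y x' y' : Fin N → ℝ)
    (hxX : x ∈ X) (hyX : y ∈ X) (hx'X : x' ∈ X) (hy'X : y' ∈ X)
    (hBdd1 : BddBelow ((fun u => F u - ∑ n, σ n * u n) '' X))
    (hBdd2 : BddBelow ((fun u => (F u + φ u) - ∑ n, σ n * u n) '' X))
    (hBdd3 : BddBelow ((fun u =>
      F u - ∑ n, (σ + (q * L * N) • (Pi.single i 1 : Fin N → ℝ)) n * u n) '' X))
    (hBdd4 : BddBelow ((fun u =>
      (F u + φ u) - ∑ n, (σ + (q * L * N) • (Pi.single i 1 : Fin N → ℝ)) n * u n) '' X))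
    (hx : F x - ∑ n, σ n * x n ≤ sInf ((fun u => F u - ∑ n, σ n * u n) '' X) + ε)
    (hy : (F y + φ y) - ∑ n, σ n * y n ≤
      sInf ((fun u => (F u + φ u) - ∑ n, σ n * u n) '' X) + ε)
    (hx' : F x' - ∑ n, (σ + (q * L * N) • (Pi.single i 1 : Fin N → ℝ)) n * x' n ≤
      sInf ((fun u =>
        F u - ∑ n, (σ + (q * L * N) • (Pi.single i 1 : Fin N → ℝ)) n * u n) '' X) + ε)
    (hy' : (F y' + φ y') - ∑ n, (σ + (q * L * N) • (Pi.single i 1 : Fin N → ℝ)) n * y' n ≤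
      sInf ((fun u =>
        (F u + φ u) - ∑ n, (σ + (q * L * N) • (Pi.single i 1 : Fin N → ℝ)) n * u n) '' X) + ε)
    (hxy : (∑ n, |x n - y n|) ≤ p * N * |x i - y i|) :
    max (x i) (y i) - (p * h / q) * |x i - y i| - 3 * ε / (q * L * N) ≤ min (x' i) (y' i) := by
  have hN : (0 : ℝ) < N := by
    have : 0 < N := i.pos
    exact_mod_cast this
  have hc : 0 < q * L * N := by positivity
  have key : ∀ u : Fin N → ℝ, ∑ n, (σ + (q * L * N) • (Pi.single i 1 : Fin N → ℝ)) n * u n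
      = (∑ n, σ n * u n) + q * L * N * u i := by
    intro u
    simp only [Pi.add_apply, Pi.smul_apply, smul_eq_mul, add_mul, Finset.sum_add_distrib]
    congr 1
    rw [Finset.sum_eq_single i]
    · simp
    · intro b _ hb
      simp [Pi.single_eq_of_ne hb]
    · simp
  have h1 : ∀ u ∈ X, F x - ∑ n, σ n * x n ≤ F u - ∑ n, σ n * u n + ε := fun u hu => by
    have := csInf_le hBdd1 (Set.mem_image_of_mem _ hu)
    linarith
  have h2 : ∀ u ∈ X, F y + φ y - ∑ n, σ n * y n ≤ F u + φ u - ∑ n, σ n * u n + ε :=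
    fun u hu => by
      have := csInf_le hBdd2 (Set.mem_image_of_mem _ hu)
      linarith
  have h3 : ∀ u ∈ X, F x' - (∑ n, σ n * x' n + q * L * N * x' i)
      ≤ F u - (∑ n, σ n * u n + q * L * N * u i) + ε := fun u hu => by
    have := csInf_le hBdd3 (Set.mem_image_of_mem _ hu)
    rw [← key, ← key]
    linarith
  have h4 : ∀ u ∈ X, F y' + φ y' - (∑ n, σ n * y' n + q * L * N * y' i)
      ≤ F u + φ u - (∑ n, σ n * u n + q * L * N * u i) + ε := fun u hu => by
    have := csInf_le hBdd4 (Set.mem_image_of_mem _ hu)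
    rw [← key, ← key]
    linarith
  have hf : |φ x - φ y| ≤ q * L * N * (p * h / q * |x i - y i|) := by
    calc |φ x - φ y| ≤ (h * L) * ∑ n, |x n - y n| := hφ x hxX y hyX
      _ ≤ (h * L) * (p * N * |x i - y i|) := by gcongr
      _ = _ := by field_simp
  obtain ⟨hf1, hf2⟩ := abs_le.mp hf
  have hd : 0 ≤ q * L * N * (p * h / q * |x i - y i|) := (abs_nonneg _).trans hf
  have he : q * L * N * (3 * ε / (q * L * N)) = 3 * ε := mul_div_cancel₀ _ hc.ne'
  generalize p * h / q * |x i - y i| = D at *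
  generalize 3 * ε / (q * L * N) = E at *
  generalize q * L * N = c at *
  have a1 := h1 x' hx'X
  have a2 := h1 y hyX
  have a3 := h2 x hxX
  have a4 := h2 y' hy'X
  have a5 := h3 x hxX
  have a6 := h3 y hyX
  have a7 := h4 x hxX
  have a8 := h4 y hyX
  rw [sub_sub, sub_le_iff_le_add]
  refine max_le ?_ ?_ <;> rw [← sub_le_iff_le_add] <;> refine le_min ?_ ?_ <;>
    refine le_of_mul_le_mul_left ?_ hc <;> rw [mul_sub, mul_add] <;> linarith
end
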